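/- Let ⟨A, C, d, O, v, (≺_a)_{a∈A}⟩ be an infinite sequential game such that each ≺_a is a strict weak order and, for every player a and every ≺_a-terminal interval I, v^{-1}(I) is a Borel subset of C^ω (product topology, C discrete). Then the following are equivalent: (1) for every player a, every sequence of plays (p^n)_{n∈ℕ} converging to a play p in C^ω, and every strictly increasing φ : ℕ → ℕ, if for all n ∈ ℕ we have d(p_{<φ(n)}) = a, p^n_{<φ(n)} = p_{<φ(n)}, p^n_{φ(n)} ≠ p_{φ(n)}, and v(p^n) ≺_a v(p^{n+1}), then v(p^n) ≺_a v(p) for all n ∈ ℕ; (2) every finite-branching pruning of the game has a Nash equilibrium. -/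

import Mathlib

namespace SeqGame

variable {A C O : Type*}

/-- The length-`n` prefix of an infinite sequence, as a list. -/
def pre (p : ℕ → C) (n : ℕ) : List C := List.ofFn (fun i : Fin n => p i)

/-- The length-`n` history of the play induced by the strategy profile `σ` starting at `γ`. -/
def hist (σ : List C → C) (γ : List C) : ℕ → List C
  | 0 => []
  | n + 1 => hist σ γ n ++
      [if h : n < γ.length then γ.get ⟨n, h⟩ else σ (hist σ γ n)]

/-- The play `p^γ(σ)` induced by the strategy profile `σ` starting at `γ`. -/
def play (σ : List C → C) (γ : List C) (n : ℕ) : C :=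
  if h : n < γ.length then γ.get ⟨n, h⟩ else σ (hist σ γ n)

/-- `σ'` is an `a`-deviation of the strategy profile `σ`. -/
def Dev (d : List C → A) (a : A) (σ σ' : List C → C) : Prop :=
  ∀ h : List C, d h ≠ a → σ' h = σ h

/-- `r` is a strict weak order: irreflexive, transitive, with transitive incomparability. -/
def SWO (r : O → O → Prop) : Prop :=
  (∀ x, ¬ r x x) ∧ (∀ x y z, r x y → r y z → r x z) ∧
  (∀ x y z, ¬ r x y → ¬ r y z → ¬ r x z)

/-- `r` is a strict linear order: irreflexive, transitive and total. -/
def SLO (r : O → O → Prop) : Prop :=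
  (∀ x, ¬ r x x) ∧ (∀ x y z, r x y → r y z → r x z) ∧
  (∀ x y, x = y ∨ r x y ∨ r y x)

/-- The play `p` is consistent with the strategy `s` of player `a` from `γ` on. -/
def Consistent (d : List C → A) (a : A) (s : List C → C) (γ : List C) (p : ℕ → C) : Prop :=
  pre p γ.length = γ ∧ ∀ n, γ.length ≤ n → d (pre p n) = a → p n = s (pre p n)

/-- The guarantee `g_a(γ, s)` of player `a` (with preference `r`) by strategy `s` at `γ`. -/
def gua (d : List C → A) (v : (ℕ → C) → O) (r : O → O → Prop) (a : A)
    (γ : List C) (s : List C → C) : Set O :=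
  {o | ∃ p : ℕ → C, Consistent d a s γ p ∧ ¬ r o (v p)}

/-- The best guarantee `G_a(γ)` of player `a` (with preference `r`) at `γ`. -/
def Gua (d : List C → A) (v : (ℕ → C) → O) (r : O → O → Prop) (a : A) (γ : List C) : Set O :=
  ⋂ s : List C → C, gua d v r a γ s

/-- `I` is a `r`-terminal interval: `o ∈ I` and `¬(o' ≺ o)` imply `o' ∈ I`. -/
def Terminal (r : O → O → Prop) (I : Set O) : Prop :=
  ∀ o ∈ I, ∀ o', ¬ r o' o → o' ∈ I

/-- `I` is a `r`-extremal interval. -/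
def Extremal (r : O → O → Prop) (I : Set O) : Prop :=
  Terminal r I ∨ Terminal (fun x y => r y x) I

/-- `γ C^ω`: the set of plays extending the finite sequence `γ`. -/
def ext (γ : List C) : Set (ℕ → C) := {p | pre p γ.length = γ}

/-- Concatenation `γ·α` of a finite sequence and an infinite one. -/
def cat (γ : List C) (α : ℕ → C) : ℕ → C :=
  fun n => if h : n < γ.length then γ.get ⟨n, h⟩ else α (n - γ.length)

/-- The two-player win/lose game `⟨C, D, W⟩` is determined. -/
def Determined (D : Set (List C)) (W : Set (ℕ → C)) : Prop :=
  (∃ s : List C → C, ∀ p : ℕ → C, (∀ n, pre p n ∈ D → p n = s (pre p n)) → p ∈ W) ∨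
  (∃ t : List C → C, ∀ p : ℕ → C, (∀ n, pre p n ∉ D → p n = t (pre p n)) → p ∉ W)

/-- In a two-player game (`true` is player `a`, `false` is player `b`) with antagonistic
preferences, the preference of each player derived from the preference `r` of player `a`. -/
def rel (r : O → O → Prop) : Bool → O → O → Prop
  | true => r
  | false => fun o o' => r o' o

end SeqGame

universe u

/-- A pruned forest, presented by its nodes, their levels and their parents. -/
structure GTree where
  N : Type u
  lev : N → ℕ
  par : N → N
  lev_par : ∀ x, lev (par x) = lev x - 1
  exists_child : ∀ x, ∃ y, lev y = lev x + 1 ∧ par y = x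

namespace GTree

/-- `y` is a child of `x`. -/
def Ch (T : GTree.{u}) (x y : T.N) : Prop := T.lev y = T.lev x + 1 ∧ T.par y = x

/-- `x` is an infinite branch. -/
def IsPlay (T : GTree.{u}) (x : ℕ → T.N) : Prop :=
  ∀ n, T.lev (x n) = n ∧ T.par (x (n + 1)) = x n

/-- `σ` chooses a child of every node. -/
def IsStrat (T : GTree.{u}) (σ : T.N → T.N) : Prop := ∀ x, T.Ch x (σ x)

/-- The branch `x` is consistent with `σ` at the levels of parity `b`. -/
def Cons (T : GTree.{u}) (b : Bool) (σ : T.N → T.N) (x : ℕ → T.N) : Prop :=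
  ∀ n, n.bodd = b → x (n + 1) = σ (x n)

/-- `σ` and `σ'` agree at the levels of parity `b` below `n`. -/
def Agree (T : GTree.{u}) (b : Bool) (n : ℕ) (σ σ' : T.N → T.N) : Prop :=
  ∀ x, T.lev x < n → (T.lev x).bodd = b → σ x = σ' x

/-- The ancestor of `z` at level `m` (or `z` itself if its level is at most `m`). -/
def anc (T : GTree.{u}) (z : T.N) (m : ℕ) : T.N := T.par^[T.lev z - m] z

/-- `Y` is an open set of branches. -/
def Open (T : GTree.{u}) (Y : Set (ℕ → T.N)) : Prop :=
  ∀ x, T.IsPlay x → x ∈ Y → ∃ n, ∀ x', T.IsPlay x' → x' n = x n → x' ∈ Y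

variable {T : GTree.{u}}

lemma Agree.trans {b : Bool} {n : ℕ} {σ τ ρ : T.N → T.N} (h : T.Agree b n σ τ)
    (h' : T.Agree b n τ ρ) : T.Agree b n σ ρ :=
  fun x hx hb => (h x hx hb).trans (h' x hx hb)

lemma Agree.mono {b : Bool} {m n : ℕ} {σ τ : T.N → T.N} (h : T.Agree b n σ τ)
    (hmn : m ≤ n) : T.Agree b m σ τ :=
  fun x hx hb => h x (hx.trans_le hmn) hb

lemma IsPlay.lev {x : ℕ → T.N} (hx : T.IsPlay x) (n : ℕ) : T.lev (x n) = n := (hx n).1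

lemma IsPlay.ch {x : ℕ → T.N} (hx : T.IsPlay x) (n : ℕ) : T.Ch (x n) (x (n + 1)) :=
  ⟨by rw [hx.lev, hx.lev], (hx n).2⟩

lemma anc_of_le {z : T.N} {m : ℕ} (h : T.lev z ≤ m) : T.anc z m = z := by
  simp [anc, Nat.sub_eq_zero_of_le h]

lemma anc_ch {z c : T.N} (h : T.Ch z c) {m : ℕ} (hm : m ≤ T.lev z) :
    T.anc c m = T.anc z m := by
  unfold anc
  have : T.lev c - m = (T.lev z - m) + 1 := by have := h.1; omega
  rw [this, Function.iterate_succ_apply, h.2]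

lemma lev_iterate (z : T.N) (j : ℕ) : T.lev (T.par^[j] z) = T.lev z - j := by
  induction j with
  | zero => simp
  | succ j ih => rw [Function.iterate_succ_apply', T.lev_par, ih]; omega

lemma lev_anc {z : T.N} {m : ℕ} (h : m ≤ T.lev z) : T.lev (T.anc z m) = m := by
  rw [anc, lev_iterate]; omega

lemma IsPlay.anc {x : ℕ → T.N} (hx : T.IsPlay x) {m n : ℕ} (h : m ≤ n) :
    T.anc (x n) m = x m := by
  induction n, h using Nat.le_induction with
  | base => exact anc_of_le (hx.lev m).le
  | succ n hn ih => rw [anc_ch (hx.ch n) (by rwa [hx.lev]), ih]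

/-- An arbitrary child. -/
noncomputable def child (T : GTree.{u}) (x : T.N) : T.N := (T.exists_child x).choose

lemma ch_child (x : T.N) : T.Ch x (T.child x) := (T.exists_child x).choose_spec

open Classical in
/-- `y` if it is a child of `x`, and an arbitrary child of `x` otherwise. -/
noncomputable def fixc (T : GTree.{u}) (x y : T.N) : T.N := if T.Ch x y then y else T.child x

lemma ch_fixc (x y : T.N) : T.Ch x (T.fixc x y) := by
  unfold fixc; split_ifs with h
  · exact h
  · exact ch_child x

lemma fixc_of_ch {x y : T.N} (h : T.Ch x y) : T.fixc x y = y := if_pos h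

lemma exists_play (z : T.N) : ∃ x, T.IsPlay x ∧ x (T.lev z) = z := by
  refine ⟨fun n => T.child^[n - T.lev z] (T.anc z n), fun n => ?_, by simp [anc_of_le]⟩
  have key : ∀ j (w : T.N), T.lev (T.child^[j] w) = T.lev w + j := by
    intro j w
    induction j with
    | zero => simp
    | succ j ih => rw [Function.iterate_succ_apply', (ch_child _).1, ih]; omega
  rcases lt_or_ge n (T.lev z) with h | h
  · have h1 : n - T.lev z = 0 := by omega
    have h2 : n + 1 - T.lev z = 0 := by omega
    simp only [h1, h2, Function.iterate_zero, id]
    refine ⟨lev_anc h.le, ?_⟩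
    have : T.lev z - n = (T.lev z - (n + 1)) + 1 := by omega
    rw [anc, anc, this, Function.iterate_succ_apply']
  · have h2 : n + 1 - T.lev z = (n - T.lev z) + 1 := by omega
    simp only [h2]
    rw [key, anc_of_le h, anc_of_le (by omega), Function.iterate_succ_apply', (ch_child _).2]
    exact ⟨by omega, rfl⟩

section Reach

variable (T) (b : Bool) (U : Set T.N)

/-- Player `b` can force a visit to `U` from the given node, with ordinal rank. -/
inductive RW : Ordinal.{u} → T.N → Prop
  | base (α : Ordinal.{u}) (z : T.N) : z ∈ U → RW α z
  | mine (α β : Ordinal.{u}) (z c : T.N) : (T.lev z).bodd = b → T.Ch z c → β < α → RW β c →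
      RW α z
  | opp (α : Ordinal.{u}) (z : T.N) (f : T.N → Ordinal.{u}) : (T.lev z).bodd ≠ b →
      (∀ c, T.Ch z c → f c < α) → (∀ c, T.Ch z c → RW (f c) c) → RW α z

/-- The nodes from which player `b` can force a visit to `U`. -/
def Reach : Set T.N := {z | ∃ α, T.RW b U α z}

/-- The rank of a node in `Reach`. -/
noncomputable def rank (z : T.N) : Ordinal.{u} := sInf {α | T.RW b U α z}

open Classical in
/-- A strategy of player `b` forcing visits to `U` from `Reach`. -/
noncomputable def att (z : T.N) : T.N :=
  if h : ∃ c, T.Ch z c ∧ c ∈ T.Reach b U ∧ T.rank b U c < T.rank b U z then h.choose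
  else T.child z

variable {T b U}

lemma ch_att (z : T.N) : T.Ch z (T.att b U z) := by
  unfold att; split_ifs with h
  · exact h.choose_spec.1
  · exact ch_child z

lemma subset_reach : U ⊆ T.Reach b U := fun _ hz => ⟨0, .base _ _ hz⟩

lemma reach_of_ch {z c : T.N} (hb : (T.lev z).bodd = b) (h : T.Ch z c) (hc : c ∈ T.Reach b U) :
    z ∈ T.Reach b U := by
  obtain ⟨α, hα⟩ := hc
  exact ⟨Order.succ α, .mine _ _ _ _ hb h (Order.lt_succ α) hα⟩

lemma reach_of_forall_ch {z : T.N} (hb : (T.lev z).bodd ≠ b)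
    (h : ∀ c, T.Ch z c → c ∈ T.Reach b U) : z ∈ T.Reach b U := by
  choose! f hf using h
  refine ⟨⨆ c, Order.succ (f c), .opp _ _ f hb (fun c _ => ?_) hf⟩
  exact (Order.lt_succ _).trans_le (Ordinal.le_iSup (fun c => Order.succ (f c)) c)

lemma exists_ch_not_reach {z : T.N} (h : z ∉ T.Reach b U) :
    ∃ c, T.Ch z c ∧ c ∉ T.Reach b U := by
  by_contra! hc
  by_cases hb : (T.lev z).bodd = b
  · exact h (reach_of_ch hb (ch_child z) (hc _ (ch_child z)))
  · exact h (reach_of_forall_ch hb hc)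

lemma rank_le {z : T.N} {α : Ordinal.{u}} (h : T.RW b U α z) : T.rank b U z ≤ α :=
  csInf_le' h

lemma rw_rank {z : T.N} (h : z ∈ T.Reach b U) : T.RW b U (T.rank b U z) z := csInf_mem h

lemma reach_next {z c : T.N} (h : z ∈ T.Reach b U) (hU : z ∉ U) (hc : T.Ch z c)
    (hatt : (T.lev z).bodd = b → c = T.att b U z) :
    c ∈ T.Reach b U ∧ T.rank b U c < T.rank b U z := by
  have := rw_rank h
  generalize hα : T.rank b U z = α at this
  cases this with
  | base _ _ h' => exact absurd h' hU
  | mine _ β _ c' hb hc' hβ hr =>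
    have hex : ∃ c, T.Ch z c ∧ c ∈ T.Reach b U ∧ T.rank b U c < T.rank b U z :=
      ⟨c', hc', ⟨β, hr⟩, by rw [hα]; exact (rank_le hr).trans_lt hβ⟩
    rw [hatt hb, att, dif_pos hex, ← hα]
    exact hex.choose_spec.2
  | opp _ _ f hb hf hr =>
    exact ⟨⟨_, hr c hc⟩, (rank_le (hr c hc)).trans_lt (hf c hc)⟩

lemma exists_mem_of_reach {x : ℕ → T.N} (hx : T.IsPlay x) {n : ℕ} (hn : x n ∈ T.Reach b U)
    (hatt : ∀ m, n ≤ m → (∀ j, n ≤ j → j ≤ m → x j ∉ U) → x m ∈ T.Reach b U → m.bodd = b →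
      x (m + 1) = T.att b U (x m)) :
    ∃ m, n ≤ m ∧ x m ∈ U := by
  by_contra! hU
  have key : ∀ α : Ordinal.{u}, ∀ m, n ≤ m → x m ∈ T.Reach b U → T.rank b U (x m) = α →
      False := by
    intro α
    induction α using WellFoundedLT.induction with
    | ind α ih =>
      intro m hm hr hα
      obtain ⟨h1, h2⟩ := reach_next hr (hU m hm) (hx.ch m)
        (fun hb => hatt m hm (fun j hj _ => hU j hj) hr (by rwa [hx.lev] at hb))
      exact ih _ (hα ▸ h2) (m + 1) (by omega) h1 rfl
  exact key _ n le_rfl hn rfl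

end Reach

/-- Open games with at most one root are determined. -/
lemma open_determined {T : GTree.{u}} (hroot : ∀ x y : T.N, T.lev x = 0 → T.lev y = 0 → x = y)
    {Y : Set (ℕ → T.N)} (hY : T.Open Y) :
    (∃ σ, T.IsStrat σ ∧ ∀ x, T.IsPlay x → T.Cons false σ x → x ∈ Y) ∨
    (∃ σ, T.IsStrat σ ∧ ∀ x, T.IsPlay x → T.Cons true σ x → x ∉ Y) := by
  set U : Set T.N := {z | ∀ x, T.IsPlay x → x (T.lev z) = z → x ∈ Y} with hUdef
  by_cases h : ∃ r, T.lev r = 0 ∧ r ∈ T.Reach false U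
  · obtain ⟨r, hr0, hr⟩ := h
    refine Or.inl ⟨T.att false U, ch_att, fun x hx hc => ?_⟩
    have h0 : x 0 = r := hroot _ _ (hx.lev 0) hr0
    obtain ⟨m, -, hm⟩ := exists_mem_of_reach hx (n := 0) (h0 ▸ hr)
      (fun m _ _ _ hb => hc m hb)
    exact hm x hx (by rw [hx.lev])
  · push Not at h
    classical
    have hex : ∀ z, ∃ c, T.Ch z c ∧ (z ∉ T.Reach false U → c ∉ T.Reach false U) := by
      intro z
      by_cases hz : z ∈ T.Reach false U
      · exact ⟨_, ch_child z, fun h' => absurd hz h'⟩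
      · obtain ⟨c, hc, hc'⟩ := exists_ch_not_reach hz
        exact ⟨c, hc, fun _ => hc'⟩
    choose σ hσ hσ' using hex
    refine Or.inr ⟨σ, hσ, fun x hx hc hxY => ?_⟩
    have key : ∀ n, x n ∉ T.Reach false U := by
      intro n
      induction n with
      | zero => exact h _ (hx.lev 0)
      | succ n ih =>
        cases hb : n.bodd with
        | false => exact fun h' => ih (reach_of_ch (by rwa [hx.lev]) (hx.ch n) h')
        | true => rw [hc n hb]; exact hσ' _ ih
    obtain ⟨n, hn⟩ := hY x hx hxY
    refine key n (subset_reach fun x' hx' he => hn x' hx' ?_)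
    rwa [hx.lev] at he

end GTree

namespace GTree

/-- A covering of `T` by `T'`: a tree map together with a local transport of strategies such
that every branch consistent with a transported strategy lifts. -/
structure Covering (T' T : GTree.{u}) where
  π : T'.N → T.N
  lev_π : ∀ x, T.lev (π x) = T'.lev x
  par_π : ∀ x, π (T'.par x) = T.par (π x)
  φ : Bool → (T'.N → T'.N) → T.N → T.N
  strat : ∀ b σ, T'.IsStrat σ → T.IsStrat (φ b σ)
  loc : ∀ b n σ σ', T'.IsStrat σ → T'.IsStrat σ' → T'.Agree b n σ σ' →
    T.Agree b n (φ b σ) (φ b σ')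
  lift : ∀ b σ, T'.IsStrat σ → ∀ x, T.IsPlay x → T.Cons b (φ b σ) x →
    ∃ x', T'.IsPlay x' ∧ T'.Cons b σ x' ∧ ∀ n, π (x' n) = x n

namespace Covering

/-- The covering is an isomorphism up to level `k`. -/
structure IsK {T' T : GTree.{u}} (c : Covering T' T) (k : ℕ) : Prop where
  inj : ∀ x y, T'.lev x ≤ k → c.π x = c.π y → x = y
  surj : ∀ z, T.lev z ≤ k → ∃ x, c.π x = z
  strat_eq : ∀ b σ, T'.IsStrat σ → ∀ x, T'.lev x < k → (T'.lev x).bodd = b →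
    c.φ b σ (c.π x) = c.π (σ x)

variable {T'' T' T : GTree.{u}}

lemma IsK.mono {c : Covering T' T} {k l : ℕ} (h : c.IsK k) (hl : l ≤ k) : c.IsK l where
  inj x y hx := h.inj x y (hx.trans hl)
  surj z hz := h.surj z (hz.trans hl)
  strat_eq b σ hσ x hx := h.strat_eq b σ hσ x (hx.trans_le hl)

lemma isPlay_π (c : Covering T' T) {x : ℕ → T'.N} (h : T'.IsPlay x) :
    T.IsPlay fun n => c.π (x n) :=
  fun n => ⟨by rw [c.lev_π, h.lev], by rw [← c.par_π, (h n).2]⟩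

/-- Composition of coverings. -/
def comp (c : Covering T' T) (c' : Covering T'' T') : Covering T'' T where
  π x := c.π (c'.π x)
  lev_π x := by rw [c.lev_π, c'.lev_π]
  par_π x := by rw [c'.par_π, c.par_π]
  φ b σ := c.φ b (c'.φ b σ)
  strat b σ h := c.strat _ _ (c'.strat _ _ h)
  loc b n σ σ' h h' ha := c.loc _ _ _ _ (c'.strat _ _ h) (c'.strat _ _ h')
    (c'.loc _ _ _ _ h h' ha)
  lift b σ h x hx hc := by
    obtain ⟨x', hx', hc', he⟩ := c.lift b _ (c'.strat b _ h) x hx hc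
    obtain ⟨x'', hx'', hc'', he'⟩ := c'.lift b _ h x' hx' hc'
    exact ⟨x'', hx'', hc'', fun n => by rw [he', he]⟩

lemma IsK.comp {c : Covering T' T} {c' : Covering T'' T'} {k : ℕ} (h : c.IsK k)
    (h' : c'.IsK k) : (c.comp c').IsK k where
  inj x y hx hxy := h'.inj x y hx (h.inj _ _ (by rwa [c'.lev_π]) hxy)
  surj z hz := by
    obtain ⟨y, rfl⟩ := h.surj z hz
    obtain ⟨x, rfl⟩ := h'.surj y (by rwa [c.lev_π] at hz)
    exact ⟨x, rfl⟩
  strat_eq b σ hσ x hx hb := by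
    change c.φ b (c'.φ b σ) (c.π (c'.π x)) = c.π (c'.π (σ x))
    rw [h.strat_eq b _ (c'.strat b σ hσ) (c'.π x) (by rwa [c'.lev_π]) (by rwa [c'.lev_π]),
      h'.strat_eq b σ hσ x hx hb]

section Limit

variable (S : ℕ → GTree.{u}) (c : ∀ i, Covering (S (i + 1)) (S i))

/-- Compatible families of nodes. -/
def LimN : Type u := {x : ∀ i, (S i).N // ∀ i, (c i).π (x (i + 1)) = x i}

variable {S c}

lemma lev_lim (x : LimN S c) (i : ℕ) : (S i).lev (x.1 i) = (S 0).lev (x.1 0) := by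
  induction i with
  | zero => rfl
  | succ i ih => rw [← ih, ← x.2 i, (c i).lev_π]

lemma lim_eq_of_eventually {x y : LimN S c} {m : ℕ} (h : ∀ i, m ≤ i → x.1 i = y.1 i) :
    x = y := by
  have : ∀ j i, m ≤ i + j → x.1 i = y.1 i := by
    intro j
    induction j with
    | zero => exact h
    | succ j ih => intro i hi; rw [← x.2, ← y.2, ih (i + 1) (by omega)]
  exact Subtype.ext (funext fun i => this m i (by omega))

lemma lim_inj {k : ℕ} (hK : ∀ i, (c i).IsK (k + i)) {x y : LimN S c} (j : ℕ)
    (hl : (S j).lev (x.1 j) ≤ k + j) (h : x.1 j = y.1 j) : x = y := by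
  refine lim_eq_of_eventually (m := j) fun i hi => ?_
  induction i, hi using Nat.le_induction with
  | base => exact h
  | succ i hi ih =>
    refine (hK i).inj _ _ ?_ (by rw [x.2, y.2, ih])
    rw [lev_lim]; rw [lev_lim] at hl; omega

lemma lim_surj (j : ℕ) : ∀ (S : ℕ → GTree.{u}) (c : ∀ i, Covering (S (i + 1)) (S i)) (k : ℕ),
    (∀ i, (c i).IsK (k + i)) → ∀ z : (S j).N, (S j).lev z ≤ k + j →
    ∃ x : LimN S c, x.1 j = z := by
  induction j with
  | zero =>
    intro S c k hK z hz
    have hs : ∀ i (w : (S i).N), ∃ w', (S i).lev w ≤ k + i → (c i).π w' = w := by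
      intro i w
      by_cases h : (S i).lev w ≤ k + i
      · obtain ⟨w', hw'⟩ := (hK i).surj w h
        exact ⟨w', fun _ => hw'⟩
      · obtain ⟨w', -⟩ := (S (i+1)).exists_play ((hK i).surj ((S i).anc w 0)
          (by rw [lev_anc (Nat.zero_le _)]; omega)).choose
        exact ⟨w' 0, fun h' => absurd h' h⟩
    choose g hg using hs
    let x : ∀ i, (S i).N := fun i => Nat.rec z (fun i w => g i w) i
    have hl : ∀ i, (S i).lev (x i) ≤ k := by
      intro i
      induction i with
      | zero => exact hz
      | succ i ih =>
        rw [← (c i).lev_π]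
        exact (congrArg (S i).lev (hg i (x i) (by omega))).trans_le ih
    exact ⟨⟨x, fun i => hg i (x i) (by have := hl i; omega)⟩, rfl⟩
  | succ j ih =>
    intro S c k hK z hz
    obtain ⟨x, hx⟩ := ih (fun i => S (i + 1)) (fun i => c (i + 1)) (k + 1)
      (fun i => by rw [show k + 1 + i = k + (i + 1) by omega]; exact hK (i + 1)) z (by omega)
    let y : ∀ i, (S i).N := fun i => Nat.casesOn i ((c 0).π (x.1 0)) (fun i => x.1 i)
    refine ⟨⟨y, fun i => ?_⟩, hx⟩
    cases i with
    | zero => rfl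
    | succ i => exact x.2 i

variable (S c) in
/-- The inverse limit of a sequence of coverings. -/
def limTree (k : ℕ) (hK : ∀ i, (c i).IsK (k + i)) : GTree.{u} where
  N := LimN S c
  lev x := (S 0).lev (x.1 0)
  par x := ⟨fun i => (S i).par (x.1 i), fun i => by rw [(c i).par_π, x.2]⟩
  lev_par x := (S 0).lev_par _
  exists_child x := by
    set n := (S 0).lev (x.1 0) with hn
    have hy := ch_child (T := S (n + 1)) (x.1 (n + 1))
    have hly : (S (n + 1)).lev ((S (n + 1)).child (x.1 (n + 1))) = n + 1 := by
      rw [hy.1, lev_lim]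
    obtain ⟨y, hy'⟩ := lim_surj (n + 1) S c k hK _ (by rw [hly]; omega)
    refine ⟨y, by rw [← lev_lim y (n + 1), hy', hly], ?_⟩
    refine lim_inj hK (n + 1) ?_ (by change (S (n+1)).par (y.1 (n + 1)) = _; rw [hy', hy.2])
    change (S (n+1)).lev ((S (n+1)).par (y.1 (n + 1))) ≤ _
    rw [(S (n+1)).lev_par, hy', hly]; omega

variable {k : ℕ} (hK : ∀ i, (c i).IsK (k + i))

open Classical in
variable (S c k) in
/-- A strategy on the limit seen on the low levels of the `j`-th tree. -/
noncomputable def tr (σ : LimN S c → LimN S c) (j : ℕ) (z : (S j).N) : (S j).N :=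
  if h : (S j).lev z < k + j ∧ ∃ x : LimN S c, x.1 j = z then (σ h.2.choose).1 j
  else (S j).child z

lemma tr_apply (hK : ∀ i, (c i).IsK (k + i)) (σ : LimN S c → LimN S c) {j : ℕ} (x : LimN S c)
    (h : (S j).lev (x.1 j) < k + j) : tr S c k σ j (x.1 j) = (σ x).1 j := by
  have h' : (S j).lev (x.1 j) < k + j ∧ ∃ y : LimN S c, y.1 j = x.1 j := ⟨h, x, rfl⟩
  rw [tr, dif_pos h']
  rw [lim_inj hK j (x := h'.2.choose) (y := x) (by rw [h'.2.choose_spec]; omega)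
    h'.2.choose_spec]

lemma ch_lim {x y : LimN S c} (h : (limTree S c k hK).Ch x y) (j : ℕ) :
    (S j).Ch (x.1 j) (y.1 j) := by
  refine ⟨?_, ?_⟩
  · rw [lev_lim y, lev_lim x]; exact h.1
  · rw [← h.2]; rfl

lemma isStrat_tr {σ : LimN S c → LimN S c} (hσ : (limTree S c k hK).IsStrat σ) (j : ℕ) :
    (S j).IsStrat (tr S c k σ j) := by
  intro z
  unfold tr
  split_ifs with h
  · have := ch_lim hK (hσ h.2.choose) j
    rwa [h.2.choose_spec] at this
  · exact ch_child z

variable (S c k) in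
/-- Successive approximations to the transported strategies. -/
noncomputable def approx (b : Bool) (σ : LimN S c → LimN S c) :
    ℕ → ∀ j, (S j).N → (S j).N
  | 0, j => tr S c k σ j
  | r + 1, j => (c j).φ b (approx b σ r (j + 1))

lemma isStrat_approx (b : Bool) {σ : LimN S c → LimN S c} (hσ : (limTree S c k hK).IsStrat σ)
    (r : ℕ) : ∀ j, (S j).IsStrat (approx S c k b σ r j) := by
  induction r with
  | zero => exact isStrat_tr hK hσ
  | succ r ih => exact fun j => (c j).strat _ _ (ih (j + 1))

lemma approx_succ (b : Bool) {σ : LimN S c → LimN S c} (hσ : (limTree S c k hK).IsStrat σ)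
    (r : ℕ) : ∀ j, (S j).Agree b (k + j + r) (approx S c k b σ (r + 1) j)
      (approx S c k b σ r j) := by
  induction r with
  | zero =>
    intro j z hz hb
    change (c j).φ b (tr S c k σ (j + 1)) z = tr S c k σ j z
    obtain ⟨x, rfl⟩ := lim_surj j S c k hK z (by omega)
    rw [tr_apply hK σ x hz, ← x.2 j]
    have hl : (S (j + 1)).lev (x.1 (j + 1)) = (S j).lev (x.1 j) := by
      rw [lev_lim x (j + 1), lev_lim x j]
    rw [(hK j).strat_eq b _ (isStrat_tr hK hσ _) _ (by omega) (by rwa [hl]),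
      tr_apply hK σ x (by omega), (σ x).2]
  | succ r ih =>
    intro j
    refine (c j).loc b _ _ _ (isStrat_approx hK b hσ _ _) (isStrat_approx hK b hσ _ _) ?_
    have := ih (j + 1)
    rwa [show k + (j + 1) + r = k + j + (r + 1) by omega] at this

variable (S c k) in
/-- The strategy on the `j`-th tree transported from the limit. -/
noncomputable def down (b : Bool) (σ : LimN S c → LimN S c) (j : ℕ) (z : (S j).N) : (S j).N :=
  approx S c k b σ ((S j).lev z + 1) j z

lemma isStrat_down (b : Bool) {σ : LimN S c → LimN S c} (hσ : (limTree S c k hK).IsStrat σ)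
    (j : ℕ) : (S j).IsStrat (down S c k b σ j) :=
  fun z => isStrat_approx hK b hσ _ j z

lemma approx_agree (b : Bool) {σ : LimN S c → LimN S c} (hσ : (limTree S c k hK).IsStrat σ)
    (r i j : ℕ) : (S j).Agree b (k + j + r) (approx S c k b σ (r + i) j)
      (approx S c k b σ r j) := by
  induction i with
  | zero => exact fun _ _ _ => rfl
  | succ i ih => exact ((approx_succ hK b hσ (r + i) j).mono (by omega)).trans ih

lemma down_agree (b : Bool) {σ : LimN S c → LimN S c} (hσ : (limTree S c k hK).IsStrat σ)
    (r j : ℕ) : (S j).Agree b (k + j + r) (down S c k b σ j) (approx S c k b σ r j) := by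
  intro z hz hb
  unfold down
  rcases le_total r ((S j).lev z + 1) with h | h
  · obtain ⟨i, hi⟩ := Nat.exists_eq_add_of_le h
    rw [hi]
    exact approx_agree hK b hσ r i j z hz hb
  · obtain ⟨i, hi⟩ := Nat.exists_eq_add_of_le h
    rw [hi]
    exact (approx_agree hK b hσ _ i j z (by omega) hb).symm

lemma φ_down (b : Bool) {σ : LimN S c → LimN S c} (hσ : (limTree S c k hK).IsStrat σ)
    (j : ℕ) (z : (S j).N) (hb : ((S j).lev z).bodd = b) :
    (c j).φ b (down S c k b σ (j + 1)) z = down S c k b σ j z := by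
  have h1 := (c j).loc b _ _ _ (isStrat_down hK b hσ _) (isStrat_approx hK b hσ _ _)
    (down_agree hK b hσ ((S j).lev z) (j + 1))
  rw [h1 z (by omega) hb]
  rfl

lemma approx_congr (b : Bool) {σ σ' : LimN S c → LimN S c}
    (hσ : (limTree S c k hK).IsStrat σ) (hσ' : (limTree S c k hK).IsStrat σ') {n : ℕ}
    (h : (limTree S c k hK).Agree b n σ σ') (r : ℕ) :
    ∀ j, (S j).Agree b n (approx S c k b σ r j) (approx S c k b σ' r j) := by
  induction r with
  | zero =>
    intro j z hz hb
    change tr S c k σ j z = tr S c k σ' j z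
    unfold tr
    split_ifs with h'
    · have hl : (S 0).lev (h'.2.choose.1 0) = (S j).lev z := by
        rw [← lev_lim _ j, h'.2.choose_spec]
      rw [h h'.2.choose (hl.trans_lt hz) ((congrArg Nat.bodd hl).trans hb)]
    · rfl
  | succ r ih =>
    exact fun j => (c j).loc b _ _ _ (isStrat_approx hK b hσ _ _)
      (isStrat_approx hK b hσ' _ _) (ih (j + 1))

lemma lift_lim (b : Bool) {σ : LimN S c → LimN S c} (hσ : (limTree S c k hK).IsStrat σ)
    (x : ℕ → (S 0).N) (hx : (S 0).IsPlay x) (hc : (S 0).Cons b (down S c k b σ 0) x) :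
    ∃ x', (limTree S c k hK).IsPlay x' ∧ (limTree S c k hK).Cons b σ x' ∧
      ∀ n, (x' n).1 0 = x n := by
  let St (j : ℕ) := {y : ℕ → (S j).N // (S j).IsPlay y ∧ (S j).Cons b (down S c k b σ j) y}
  have step : ∀ j (y : St j), ∃ y' : St (j + 1), ∀ n, (c j).π (y'.1 n) = y.1 n := by
    rintro j ⟨y, hy, hyc⟩
    obtain ⟨y', h1, h2, h3⟩ := (c j).lift b _ (isStrat_down hK b hσ (j + 1)) y hy
      (fun n hn => by rw [φ_down hK b hσ j _ (by rwa [hy.lev])]; exact hyc n hn)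
    exact ⟨⟨y', h1, h2⟩, h3⟩
  choose g hg using step
  let Y : ∀ j, St j := fun j => Nat.rec ⟨x, hx, hc⟩ (fun j y => g j y) j
  have hY : ∀ j n, (c j).π ((Y (j + 1)).1 n) = (Y j).1 n := fun j n => hg j (Y j) n
  let x' : ℕ → LimN S c := fun n => ⟨fun j => (Y j).1 n, fun j => hY j n⟩
  refine ⟨x', fun n => ⟨(Y 0).2.1.lev n, ?_⟩, fun n hn => ?_, fun n => rfl⟩
  · exact Subtype.ext (funext fun j => ((Y j).2.1 n).2)
  · refine lim_eq_of_eventually (m := n + 1) fun j hj => ?_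
    have hl : (S j).lev ((x' n).1 j) = n := (Y j).2.1.lev n
    rw [← tr_apply hK σ (x' n) (by omega)]
    have h1 := (Y j).2.2 n hn
    have h2 := down_agree hK b hσ 0 j ((x' n).1 j) (by omega) (by rw [hl]; exact hn)
    exact h1.trans h2

variable (S c k) in
/-- The covering of the first tree by the limit. -/
noncomputable def limCov : Covering (limTree S c k hK) (S 0) where
  π x := x.1 0
  lev_π _ := rfl
  par_π _ := rfl
  φ b σ := down S c k b σ 0
  strat b _ h := isStrat_down hK b h 0
  loc b _ _ _ h h' ha z hz hb := approx_congr hK b h h' ha _ 0 z hz hb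
  lift b _ h x hx hc := lift_lim hK b h x hx hc

lemma isK_limCov : (limCov S c k hK).IsK k where
  inj x y hx h := lim_inj hK 0 hx h
  surj z hz := lim_surj 0 S c k hK z hz
  strat_eq b σ hσ x hx hb := by
    change down S c k b σ 0 (x.1 0) = (σ x).1 0
    rw [← tr_apply hK σ x hx]
    exact down_agree hK b hσ 0 0 (x.1 0) hx hb

lemma isPlay_lim {x : ℕ → LimN S c} (hx : (limTree S c k hK).IsPlay x) (j : ℕ) :
    (S j).IsPlay fun n => (x n).1 j :=
  fun n => ⟨by rw [lev_lim]; exact hx.lev n,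
    congrArg (fun y : LimN S c => y.1 j) (hx n).2⟩

end Limit
end Covering
end GTree

namespace GTree

section Unravel

variable (T : GTree.{u}) (k : ℕ) (Q : Set T.N)

/-- The nodes comparable with `u`. -/
def cone (u : T.N) : Set T.N := {z | T.anc u (T.lev z) = z ∨ T.anc z (T.lev u) = u}

/-- `A` is a quasi-strategy of player `false` containing `x`. -/
def QStrat (x : T.N) (A : Set T.N) : Prop :=
  x ∈ A ∧ ∀ z ∈ A, ((T.lev z).bodd = true → ∀ c, T.Ch z c → c ∈ A) ∧ ∃ c, T.Ch z c ∧ c ∈ A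

/-- `B` is the label by which player `true` announces that the node `u` outside `Q` is visited. -/
def Exit (y : T.N) (A B : Set T.N) (u : T.N) : Prop :=
  u ∈ A ∧ u ∉ Q ∧ k + 2 ≤ T.lev u ∧ T.anc u (k + 2) = y ∧ B = T.cone u

/-- `B` is a label by which player `true` announces that the branch stays in `Q`. -/
def Stay (A B : Set T.N) : Prop :=
  B ⊆ Q ∧ ∀ z ∈ B, (T.lev z).bodd = false → ∀ c, T.Ch z c → c ∈ A → c ∈ B

/-- `B` is a legal label for player `true`. -/
def Answer (y : T.N) (A B : Set T.N) : Prop :=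
  y ∈ B ∧ (∀ z ∈ B, k + 2 ≤ T.lev z → ∃ c, T.Ch z c ∧ c ∈ B) ∧
    ((∃ u, T.Exit k Q y A B u) ∨ T.Stay Q A B)

/-- Compatibility of a node with the labels. -/
structure Good (z : T.N) (A B : Set T.N) : Prop where
  qstrat : k + 1 ≤ T.lev z → T.QStrat (T.anc z (k + 1)) A
  answer : k + 2 ≤ T.lev z → T.Answer k Q (T.anc z (k + 2)) A B
  mem : ∀ m, k + 2 ≤ m → m ≤ T.lev z → T.anc z m ∈ B

/-- A node together with the labels, erased at the low levels. -/
noncomputable def lab (z : T.N) (A B : Set T.N) : T.N × Set T.N × Set T.N :=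
  (z, if T.lev z ≤ k then ∅ else A, if T.lev z ≤ k + 1 then ∅ else B)

/-- Legal labelled nodes. -/
def Legal (q : T.N × Set T.N × Set T.N) : Prop :=
  T.Good k Q q.1 q.2.1 q.2.2 ∧ q = T.lab k q.1 q.2.1 q.2.2

variable {T k Q}

lemma lab_lab (z z' : T.N) (A B : Set T.N) (h : T.lev z' ≤ T.lev z) :
    T.lab k z' (T.lab k z A B).2.1 (T.lab k z A B).2.2 = T.lab k z' A B := by
  unfold lab
  refine Prod.ext rfl (Prod.ext ?_ ?_)
  · change (if _ then _ else (if _ then _ else _)) = (if _ then _ else _)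
    split_ifs <;> first | rfl | omega
  · change (if _ then _ else (if _ then _ else _)) = (if _ then _ else _)
    split_ifs <;> first | rfl | omega

lemma legal_lab {z : T.N} {A B : Set T.N} (h : T.Good k Q z A B) :
    T.Legal k Q (T.lab k z A B) := by
  refine ⟨⟨fun h' => ?_, fun h' => ?_, fun m h1 h2 => ?_⟩, (lab_lab z z A B le_rfl).symm⟩
  · have h' : k + 1 ≤ T.lev z := h'
    have : ¬ T.lev z ≤ k := by omega
    simpa [lab, this] using h.qstrat h'
  · have h' : k + 2 ≤ T.lev z := h'
    have h1 : ¬ T.lev z ≤ k := by omega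
    have h2 : ¬ T.lev z ≤ k + 1 := by omega
    simpa [lab, h1, h2] using h.answer h'
  · have h2 : m ≤ T.lev z := h2
    have h3 : ¬ T.lev z ≤ k + 1 := by omega
    simpa [lab, h3] using h.mem m h1 h2

lemma good_low {z : T.N} (A B : Set T.N) (h : T.lev z ≤ k) : T.Good k Q z A B :=
  ⟨fun h' => by omega, fun h' => by omega, fun m h1 h2 => by omega⟩

lemma Good.of_ch {z c : T.N} {A B : Set T.N} (h : T.Good k Q c A B) (hc : T.Ch z c) :
    T.Good k Q z A B := by
  have := hc.1
  refine ⟨fun h' => ?_, fun h' => ?_, fun m h1 h2 => ?_⟩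
  · rw [← anc_ch hc h']; exact h.qstrat (by omega)
  · rw [← anc_ch hc h']; exact h.answer (by omega)
  · rw [← anc_ch hc h2]; exact h.mem m h1 (by omega)

lemma Good.ch {z c : T.N} {A B : Set T.N} (h : T.Good k Q z A B) (hc : T.Ch z c)
    (h1 : T.lev z = k → T.QStrat c A) (h2 : T.lev z = k + 1 → T.Answer k Q c A B)
    (h3 : k + 1 ≤ T.lev z → c ∈ B) : T.Good k Q c A B := by
  have hl := hc.1
  refine ⟨fun h' => ?_, fun h' => ?_, fun m hm hm' => ?_⟩
  · rcases eq_or_lt_of_le h' with h'' | h''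
    · rw [anc_of_le (by omega)]; exact h1 (by omega)
    · rw [anc_ch hc (by omega)]; exact h.qstrat (by omega)
  · rcases eq_or_lt_of_le h' with h'' | h''
    · rw [anc_of_le (by omega)]; exact h2 (by omega)
    · rw [anc_ch hc (by omega)]; exact h.answer (by omega)
  · rcases eq_or_lt_of_le hm' with h'' | h''
    · rw [anc_of_le (by omega)]; exact h3 (by omega)
    · rw [anc_ch hc (by omega)]; exact h.mem m hm (by omega)

lemma exists_mem_cone_ch {u z : T.N} (h : z ∈ T.cone u) : ∃ c, T.Ch z c ∧ c ∈ T.cone u := by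
  rcases h with h | h
  · rcases lt_or_ge (T.lev z) (T.lev u) with h' | h'
    · refine ⟨T.anc u (T.lev z + 1), ⟨lev_anc h', ?_⟩, Or.inl (by rw [lev_anc h'])⟩
      conv_rhs => rw [← h]
      have : T.lev u - T.lev z = T.lev u - (T.lev z + 1) + 1 := by omega
      rw [anc, anc, this, Function.iterate_succ_apply']
    · rw [anc_of_le h'] at h
      subst h
      exact ⟨_, ch_child u, Or.inr (by rw [anc_ch (ch_child u) le_rfl, anc_of_le le_rfl])⟩
  · rcases le_total (T.lev u) (T.lev z) with h' | h'
    · exact ⟨_, ch_child z, Or.inr (by rw [anc_ch (ch_child z) h', h])⟩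
    · rw [anc_of_le h'] at h
      subst h
      exact ⟨_, ch_child z, Or.inr (by rw [anc_ch (ch_child z) le_rfl, anc_of_le le_rfl])⟩

lemma anc_mem_cone (u : T.N) (m : ℕ) : T.anc u m ∈ T.cone u := by
  left
  rcases le_total m (T.lev u) with h | h
  · rw [lev_anc h]
  · rw [anc_of_le h, anc_of_le le_rfl]

lemma answer_cone {u : T.N} {A : Set T.N} (hu : u ∈ A) (hQ : u ∉ Q) (hl : k + 2 ≤ T.lev u) :
    T.Answer k Q (T.anc u (k + 2)) A (T.cone u) :=
  ⟨anc_mem_cone u _, fun _ h _ => exists_mem_cone_ch h, Or.inl ⟨u, hu, hQ, hl, rfl, rfl⟩⟩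

lemma exists_answer {x : T.N} {A : Set T.N} (hx : T.lev x = k + 1)
    (hA : T.QStrat x A) : ∃ y B, T.Ch x y ∧ T.Answer k Q y A B := by
  by_cases h : ∃ u ∈ A, u ∉ Q ∧ k + 2 ≤ T.lev u ∧ T.anc u (k + 1) = x
  · obtain ⟨u, hu, hQ, hl, he⟩ := h
    refine ⟨_, _, ⟨?_, ?_⟩, answer_cone hu hQ hl⟩
    · rw [lev_anc hl, hx]
    · rw [← he]
      have : T.lev u - (k + 1) = T.lev u - (k + 2) + 1 := by omega
      rw [anc, anc, this, Function.iterate_succ_apply']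
  · push Not at h
    obtain ⟨y, hy, hyA⟩ := (hA.2 x hA.1).2
    refine ⟨y, {z | z ∈ A ∧ k + 2 ≤ T.lev z ∧ T.anc z (k + 1) = x}, hy,
      ⟨hyA, by rw [hy.1, hx], by rw [anc_ch hy (by omega), anc_of_le hx.le]⟩, ?_, Or.inr ⟨?_, ?_⟩⟩
    · rintro z ⟨hz, hl, he⟩ -
      obtain ⟨c, hc, hcA⟩ := (hA.2 z hz).2
      exact ⟨c, hc, hcA, by rw [hc.1]; omega, by rw [anc_ch hc (by omega), he]⟩
    · rintro z ⟨hz, hl, he⟩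
      by_contra hQ
      exact h z hz hQ hl he
    · rintro z ⟨hz, hl, he⟩ - c hc hcA
      exact ⟨hcA, by rw [hc.1]; omega, by rw [anc_ch hc (by omega), he]⟩

lemma exists_good_ch {z : T.N} {A B : Set T.N} (h : T.Good k Q z A B) :
    ∃ c A' B', T.Ch z c ∧ T.Good k Q c A' B' ∧ T.lab k z A' B' = T.lab k z A B := by
  rcases lt_trichotomy (T.lev z) k with hl | hl | hl
  · exact ⟨_, A, B, ch_child z, good_low _ _ (by rw [(ch_child z).1]; omega), rfl⟩
  · refine ⟨_, Set.univ, B, ch_child z, (good_low Set.univ B hl.le).ch (ch_child z) (fun _ => ?_)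
      (fun _ => by omega) (fun _ => by omega), ?_⟩
    · exact ⟨trivial, fun w _ => ⟨fun _ _ _ => trivial, _, ch_child w, trivial⟩⟩
    · have : T.lev z ≤ k + 1 := by omega
      simp [lab, hl.le, this]
  · rcases eq_or_lt_of_le (Nat.succ_le_of_lt hl) with hl' | hl'
    · have hA := h.qstrat hl'.le
      rw [anc_of_le hl'.ge] at hA
      obtain ⟨y, B', hy, hB'⟩ := exists_answer (Q := Q) hl'.symm hA
      have hg : T.Good k Q z A B' := ⟨fun h' => h.qstrat h', fun _ => by omega,
        fun _ _ _ => by omega⟩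
      refine ⟨y, A, B', hy, hg.ch hy (fun _ => by omega) (fun _ => hB') (fun _ => hB'.1), ?_⟩
      have : T.lev z ≤ k + 1 := by omega
      simp [lab, this]
    · have hB := h.answer hl'
      have hz := h.mem _ hl' le_rfl
      rw [anc_of_le le_rfl] at hz
      obtain ⟨c, hc, hcB⟩ := hB.2.1 z hz hl'
      exact ⟨c, A, B, hc, h.ch hc (fun _ => by omega) (fun _ => by omega) (fun _ => hcB), rfl⟩

variable (T k Q) in
/-- The tree unravelling `Q` above level `k`. -/
noncomputable def unr (hk : k.bodd = false) : GTree.{u} where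
  N := {q // T.Legal k Q q}
  lev q := T.lev q.1.1
  par q := ⟨T.lab k (T.par q.1.1) q.1.2.1 q.1.2.2, legal_lab <| by
    by_cases h : T.lev q.1.1 = 0
    · exact good_low _ _ (by rw [T.lev_par]; omega)
    · exact q.2.1.of_ch ⟨by rw [T.lev_par]; omega, rfl⟩⟩
  lev_par q := T.lev_par _
  exists_child q := by
    obtain ⟨c, A, B, hc, hg, he⟩ := exists_good_ch q.2.1
    refine ⟨⟨_, legal_lab hg⟩, hc.1, Subtype.ext ?_⟩
    change T.lab k (T.par c) (T.lab k c A B).2.1 (T.lab k c A B).2.2 = q.1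
    rw [hc.2, lab_lab _ _ _ _ (by have := hc.1; omega), he]
    exact q.2.2.symm

open Classical in
variable (k Q) in
/-- The value of `σ` at a labelled node. -/
noncomputable def ev (σ : {q // T.Legal k Q q} → {q // T.Legal k Q q}) (z : T.N)
    (A B : Set T.N) : T.N × Set T.N × Set T.N :=
  if h : T.Legal k Q (T.lab k z A B) then (σ ⟨_, h⟩).1 else T.lab k z A B

variable {hk : k.bodd = false} {σ : {q // T.Legal k Q q} → {q // T.Legal k Q q}}

lemma ev_eq {z : T.N} {A B : Set T.N} (h : T.Good k Q z A B) :
    T.ev k Q σ z A B = (σ ⟨_, legal_lab h⟩).1 := dif_pos _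

lemma ev_agree {b : Bool} {n : ℕ} {σ' : {q // T.Legal k Q q} → {q // T.Legal k Q q}}
    (h : (T.unr k Q hk).Agree b n σ σ') {z : T.N} (hz : T.lev z < n)
    (hb : (T.lev z).bodd = b) (A B : Set T.N) : T.ev k Q σ z A B = T.ev k Q σ' z A B := by
  unfold ev
  split_ifs with h'
  · rw [h ⟨_, h'⟩ hz hb]
  · rfl

/-- The facts about the move of a strategy at a labelled node. -/
lemma ev_spec (hσ : (T.unr k Q hk).IsStrat σ) {z : T.N} {A B : Set T.N}
    (h : T.Good k Q z A B) :
    T.Ch z (T.ev k Q σ z A B).1 ∧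
    T.Good k Q (T.ev k Q σ z A B).1 (T.ev k Q σ z A B).2.1 (T.ev k Q σ z A B).2.2 ∧
    (k + 1 ≤ T.lev z → (T.ev k Q σ z A B).2.1 = A) ∧
    (k + 2 ≤ T.lev z → (T.ev k Q σ z A B).2.2 = B) := by
  rw [ev_eq h]
  have h1 := hσ ⟨_, legal_lab h⟩
  generalize σ ⟨_, legal_lab h⟩ = q at h1
  have hp : T.lab k (T.par q.1.1) q.1.2.1 q.1.2.2 = T.lab k z A B := congrArg Subtype.val h1.2
  have hz : T.par q.1.1 = z := congrArg Prod.fst hp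
  rw [hz] at hp
  refine ⟨⟨h1.1, hz⟩, q.2.1, fun hl => ?_, fun hl => ?_⟩
  · have hl' : ¬ T.lev z ≤ k := by omega
    simpa [lab, hl'] using congrArg (fun p => p.2.1) hp
  · have hl' : ¬ T.lev z ≤ k + 1 := by omega
    simpa [lab, hl'] using congrArg (fun p => p.2.2) hp

lemma eq_lab_of_legal {q : T.N × Set T.N × Set T.N} (hq : T.Legal k Q q) {A B : Set T.N}
    (hA : k + 1 ≤ T.lev q.1 → q.2.1 = A) (hB : k + 2 ≤ T.lev q.1 → q.2.2 = B) :
    q = T.lab k q.1 A B := by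
  rw [hq.2]
  unfold lab
  refine Prod.ext rfl (Prod.ext ?_ ?_)
  · dsimp only; split_ifs with h
    · rfl
    · exact hA (by omega)
  · dsimp only; split_ifs with h
    · rfl
    · exact hB (by omega)

/-- A branch with everywhere compatible labels lifts, consistently with `σ` if it follows `σ`. -/
lemma exists_lift_of_good (hσ : (T.unr k Q hk).IsStrat σ) {x : ℕ → T.N} (hx : T.IsPlay x)
    {A B : Set T.N} (hg : ∀ n, T.Good k Q (x n) A B) {b : Bool}
    (h1 : ∀ n, n.bodd = b → (T.ev k Q σ (x n) A B).1 = x (n + 1))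
    (h2 : k.bodd = b → (T.ev k Q σ (x k) A B).2.1 = A)
    (h3 : (k + 1).bodd = b → (T.ev k Q σ (x (k + 1)) A B).2.2 = B) :
    ∃ x', (T.unr k Q hk).IsPlay x' ∧ (T.unr k Q hk).Cons b σ x' ∧ ∀ n, (x' n).1.1 = x n := by
  refine ⟨fun n => ⟨_, legal_lab (hg n)⟩, fun n => ⟨hx.lev n, Subtype.ext ?_⟩, fun n hn => ?_,
    fun n => rfl⟩
  · change T.lab k (T.par (x (n + 1))) (T.lab k (x (n + 1)) A B).2.1
      (T.lab k (x (n + 1)) A B).2.2 = _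
    rw [lab_lab _ _ _ _ (by rw [T.lev_par]; omega), (hx n).2]
  · apply Subtype.ext
    change T.lab k (x (n + 1)) A B = (σ ⟨_, legal_lab (hg n)⟩).1
    have he := ev_eq (σ := σ) (hg n)
    obtain ⟨e1, e2, e3, e4⟩ := ev_spec hσ (hg n)
    have e5 := (σ ⟨_, legal_lab (hg n)⟩).2
    rw [← he] at e5 ⊢
    rw [hx.lev] at e3 e4
    have e6 : T.lev (T.ev k Q σ (x n) A B).1 = n + 1 := by rw [e1.1, hx.lev]
    rw [eq_lab_of_legal e5 (A := A) (B := B), h1 n hn]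
    · intro hl
      rcases eq_or_lt_of_le hl with h | h
      · obtain rfl : n = k := by omega
        exact h2 hn
      · exact e3 (by omega)
    · intro hl
      rcases eq_or_lt_of_le hl with h | h
      · obtain rfl : n = k + 1 := by omega
        exact h3 hn
      · exact e4 (by omega)

end Unravel
end GTree

namespace GTree

section UnravelCovering

variable {T : GTree.{u}} {k : ℕ} {Q : Set T.N}

variable (k Q) in
open Classical in
/-- Follow `σ` with labels `A₀, B₀` until `U` can be reached, then reach `U`, then follow `σ`
with the labels determined by the visited element of `U`. -/
noncomputable def rule (σ : {q // T.Legal k Q q} → {q // T.Legal k Q q}) (b : Bool)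
    (U : Set T.N) (Aof : T.N → Set T.N) (A₀ B₀ : Set T.N) (z : T.N) : T.N :=
  if {m | k + 2 ≤ m ∧ m ≤ T.lev z ∧ T.anc z m ∈ U}.Nonempty then
    T.fixc z (T.ev k Q σ z (Aof (T.anc z (sInf {m | k + 2 ≤ m ∧ m ≤ T.lev z ∧ T.anc z m ∈ U})))
      (T.cone (T.anc z (sInf {m | k + 2 ≤ m ∧ m ≤ T.lev z ∧ T.anc z m ∈ U})))).1
  else if z ∈ T.Reach b U then T.att b U z
  else T.fixc z (T.ev k Q σ z A₀ B₀).1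

variable {σ : {q // T.Legal k Q q} → {q // T.Legal k Q q}}

open Classical in
lemma ev_congr {z z' : T.N} {A B A' B' : Set T.N} (h : T.lab k z A B = T.lab k z' A' B') :
    T.ev k Q σ z A B = T.ev k Q σ z' A' B' :=
  congrArg (fun q => if h : T.Legal k Q q then (σ ⟨q, h⟩).1 else q) h

lemma ch_rule {b : Bool} {U : Set T.N} {Aof : T.N → Set T.N} {A₀ B₀ : Set T.N} (z : T.N) :
    T.Ch z (T.rule k Q σ b U Aof A₀ B₀ z) := by
  unfold rule
  split_ifs
  · exact ch_fixc _ _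
  · exact ch_att z
  · exact ch_fixc _ _

lemma rule_congr {hk : k.bodd = false} {b : Bool} {n : ℕ}
    {σ' : {q // T.Legal k Q q} → {q // T.Legal k Q q}}
    (h : (T.unr k Q hk).Agree b n σ σ') {z : T.N} (hz : T.lev z < n)
    (hb : (T.lev z).bodd = b) {U : Set T.N} {Aof : T.N → Set T.N} {A₀ B₀ : Set T.N} :
    T.rule k Q σ b U Aof A₀ B₀ z = T.rule k Q σ' b U Aof A₀ B₀ z := by
  simp only [rule, ev_agree h hz hb]

lemma rule_dichotomy {b : Bool} {U : Set T.N} (hU : ∀ u ∈ U, k + 2 ≤ T.lev u)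
    {Aof : T.N → Set T.N} {A₀ B₀ : Set T.N} {x : ℕ → T.N} (hx : T.IsPlay x)
    (hr : ∀ n, k + 1 ≤ n → n.bodd = b → x (n + 1) = T.rule k Q σ b U Aof A₀ B₀ (x n)) :
    (∃ m, k + 2 ≤ m ∧ x m ∈ U ∧ ∀ n, m ≤ n → n.bodd = b →
      x (n + 1) = T.fixc (x n) (T.ev k Q σ (x n) (Aof (x m)) (T.cone (x m))).1) ∨
    ((∀ n, k + 1 ≤ n → x n ∉ T.Reach b U) ∧ ∀ n, k + 1 ≤ n → n.bodd = b →
      x (n + 1) = T.fixc (x n) (T.ev k Q σ (x n) A₀ B₀).1) := by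
  classical
  by_cases h : ∃ m, k + 2 ≤ m ∧ x m ∈ U
  · refine Or.inl ⟨Nat.find h, (Nat.find_spec h).1, (Nat.find_spec h).2, fun n hn hb => ?_⟩
    rw [hr n (by have := (Nat.find_spec h).1; omega) hb, rule]
    have hmem : Nat.find h ∈ {m | k + 2 ≤ m ∧ m ≤ T.lev (x n) ∧ T.anc (x n) m ∈ U} :=
      ⟨(Nat.find_spec h).1, by rwa [hx.lev], by rw [hx.anc hn]; exact (Nat.find_spec h).2⟩
    have hinf : sInf {m | k + 2 ≤ m ∧ m ≤ T.lev (x n) ∧ T.anc (x n) m ∈ U} = Nat.find h := by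
      refine le_antisymm (Nat.sInf_le hmem) ?_
      obtain ⟨h1, h2, h3⟩ := Nat.sInf_mem ⟨_, hmem⟩
      refine Nat.find_min' h ⟨h1, ?_⟩
      have h2' := h2.trans (hx.lev n).le
      rwa [hx.anc h2'] at h3
    rw [if_pos ⟨_, hmem⟩, hinf, hx.anc hn]
  · push Not at h
    have hne : ∀ n, ¬ {m | k + 2 ≤ m ∧ m ≤ T.lev (x n) ∧ T.anc (x n) m ∈ U}.Nonempty := by
      rintro n ⟨m, h1, h2, h3⟩
      rw [hx.lev] at h2
      rw [hx.anc h2] at h3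
      exact h m h1 h3
    have hnr : ∀ n, k + 1 ≤ n → x n ∉ T.Reach b U := by
      intro n hn hreach
      obtain ⟨m, hm, hmU⟩ := exists_mem_of_reach hx hreach (fun m hm _ hm' hb => by
        rw [hr m (by omega) hb, rule, if_neg (hne m), if_pos hm'])
      exact h m (by have := hU _ hmU; rwa [hx.lev] at this) hmU
    exact Or.inr ⟨hnr, fun n hn hb => by
      rw [hr n hn hb, rule, if_neg (hne n), if_neg (hnr n hn)]⟩

lemma eq_of_mem_cone {x : ℕ → T.N} (hx : T.IsPlay x) {m n : ℕ} (hn : n ≤ m) {z : T.N}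
    (hz : T.lev z = n) (h : z ∈ T.cone (x m)) : z = x n := by
  rcases h with h | h
  · rw [hz, hx.anc hn] at h; exact h.symm
  · rw [hx.lev, anc_of_le (by omega)] at h
    rw [h] at hz ⊢
    rw [hx.lev] at hz
    rw [hz]

lemma mem_cone_play {x : ℕ → T.N} (hx : T.IsPlay x) (m n : ℕ) : x n ∈ T.cone (x m) := by
  rcases le_total n m with h | h
  · left; rw [hx.lev, hx.anc h]
  · right; rw [hx.lev, hx.anc h]

variable {hk : k.bodd = false}

lemma good_play {x : ℕ → T.N} (hx : T.IsPlay x) {A B : Set T.N} {n : ℕ}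
    (hA : T.QStrat (x (k + 1)) A) (hB : T.Answer k Q (x (k + 2)) A B)
    (hm : ∀ m, k + 2 ≤ m → m ≤ n → x m ∈ B) : T.Good k Q (x n) A B := by
  refine ⟨fun h => ?_, fun h => ?_, fun m h1 h2 => ?_⟩
  · rw [hx.lev] at h; rwa [hx.anc h]
  · rw [hx.lev] at h; rwa [hx.anc h]
  · rw [hx.lev] at h2; rw [hx.anc h2]; exact hm m h1 h2

lemma answer_cone_play {x : ℕ → T.N} (hx : T.IsPlay x) {A : Set T.N} {m : ℕ} (hm : k + 2 ≤ m)
    (hA : x m ∈ A) (hQ : x m ∉ Q) : T.Answer k Q (x (k + 2)) A (T.cone (x m)) := by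
  have := answer_cone (k := k) hA hQ (by rwa [hx.lev])
  rwa [hx.anc hm] at this

lemma mem_of_good {z : T.N} {A B : Set T.N} (h : T.Good k Q z A B) (hl : k + 2 ≤ T.lev z) :
    z ∈ B := by
  have := h.mem _ hl le_rfl
  rwa [anc_of_le le_rfl] at this

/-- The move of `σ` inside a cone follows the apex of the cone. -/
lemma ev_cone (hσ : (T.unr k Q hk).IsStrat σ) {x : ℕ → T.N} (hx : T.IsPlay x)
    {A : Set T.N} {m n : ℕ} (hn : k + 2 ≤ n) (hnm : n < m)
    (hg : T.Good k Q (x n) A (T.cone (x m))) :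
    (T.ev k Q σ (x n) A (T.cone (x m))).1 = x (n + 1) := by
  obtain ⟨e1, e2, e3, e4⟩ := ev_spec hσ hg
  have hl := e1.1
  rw [hx.lev] at e3 e4 hl
  rw [e4 hn] at e2
  exact eq_of_mem_cone hx hnm hl (mem_of_good e2 (by omega))

variable (k Q) in
/-- Transport of strategies of player `false`. -/
noncomputable def φI (σ : {q // T.Legal k Q q} → {q // T.Legal k Q q}) (z : T.N) : T.N :=
  if T.lev z ≤ k then T.fixc z (T.ev k Q σ z ∅ ∅).1
  else
    let A := (T.ev k Q σ (T.anc z k) ∅ ∅).2.1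
    let U := {u | u ∈ A ∧ u ∉ Q ∧ k + 2 ≤ T.lev u}
    T.rule k Q σ false U (fun _ => A) A ((T.Reach false U)ᶜ ∩ (A ∩ {z | k + 2 ≤ T.lev z})) z

variable (k Q) in
/-- The nodes `u` whose visit player `true` may announce after `x`, when following `σ`. -/
def exits (σ : {q // T.Legal k Q q} → {q // T.Legal k Q q}) (x : T.N) : Set T.N :=
  {u | ∃ A, T.QStrat x A ∧ T.Exit k Q (T.ev k Q σ x A ∅).1 A (T.ev k Q σ x A ∅).2.2 u}

open Classical in
variable (k Q) in
/-- A label for which the visit of `u` is announced. -/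
noncomputable def exitLab (σ : {q // T.Legal k Q q} → {q // T.Legal k Q q}) (x u : T.N) :
    Set T.N :=
  if h : u ∈ T.exits k Q σ x then h.choose else ∅

open Classical in
lemma exitLab_congr {σ' : {q // T.Legal k Q q} → {q // T.Legal k Q q}} {x : T.N}
    (h : T.ev k Q σ x = T.ev k Q σ' x) : T.exitLab k Q σ x = T.exitLab k Q σ' x :=
  congrArg (fun (e : Set T.N → Set T.N → T.N × Set T.N × Set T.N) (u : T.N) =>
    if h : u ∈ {u | ∃ A, T.QStrat x A ∧ T.Exit k Q (e A ∅).1 A (e A ∅).2.2 u}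
    then h.choose else ∅) h

variable (k Q) in
/-- Transport of strategies of player `true`. -/
noncomputable def φII (σ : {q // T.Legal k Q q} → {q // T.Legal k Q q}) (z : T.N) : T.N :=
  if T.lev z ≤ k then T.fixc z (T.ev k Q σ z ∅ ∅).1
  else
    let x := T.anc z (k + 1)
    let A := (T.Reach true (T.exits k Q σ x))ᶜ
    T.rule k Q σ true (T.exits k Q σ x) (T.exitLab k Q σ x) A (T.ev k Q σ x A ∅).2.2 z

lemma lift_I (hσ : (T.unr k Q hk).IsStrat σ) {x : ℕ → T.N} (hx : T.IsPlay x)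
    (hc : T.Cons false (T.φI k Q σ) x) :
    ∃ x', (T.unr k Q hk).IsPlay x' ∧ (T.unr k Q hk).Cons false σ x' ∧ ∀ n, (x' n).1.1 = x n := by
  have hlow : ∀ n, n ≤ k → n.bodd = false → ∀ A B : Set T.N,
      T.ev k Q σ (x n) A B = T.ev k Q σ (x n) ∅ ∅ := by
    intro n hn hb A B
    have : T.lab k (x n) A B = T.lab k (x n) ∅ ∅ := by
      have h1 : n ≤ k + 1 := by omega
      simp [lab, hx.lev, hn, h1]
    exact ev_congr this
  have hlow' : ∀ n, n ≤ k → n.bodd = false → ∀ A B : Set T.N,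
      (T.ev k Q σ (x n) A B).1 = x (n + 1) := by
    intro n hn hb A B
    have h1 := hc n hb
    rw [φI, hx.lev, if_pos hn, fixc_of_ch (ev_spec hσ (good_low _ _ (by rwa [hx.lev]))).1] at h1
    rw [hlow n hn hb, h1]
  have hrule : ∀ n, k + 1 ≤ n → n.bodd = false → x (n + 1) =
      (let A := (T.ev k Q σ (x k) ∅ ∅).2.1
      let U := {u | u ∈ A ∧ u ∉ Q ∧ k + 2 ≤ T.lev u}
      T.rule k Q σ false U (fun _ => A) A ((T.Reach false U)ᶜ ∩ (A ∩ {z | k + 2 ≤ T.lev z})) (x n)) := by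
    intro n hn hb
    rw [hc n hb, φI, hx.lev, if_neg (by omega), hx.anc (by omega)]
  obtain ⟨A, hAdef⟩ : ∃ A, A = (T.ev k Q σ (x k) ∅ ∅).2.1 := ⟨_, rfl⟩
  simp only [← hAdef] at hrule
  set U := {u | u ∈ A ∧ u ∉ Q ∧ k + 2 ≤ T.lev u} with hU
  have hA : T.QStrat (x (k + 1)) A := by
    have h1 := ev_spec hσ (good_low (Q := Q) ∅ ∅ (by rw [hx.lev] : T.lev (x k) ≤ k))
    rw [hlow' k le_rfl hk, ← hAdef] at h1
    have h2 := h1.2.1.qstrat (by rw [hx.lev])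
    rwa [hx.anc le_rfl] at h2
  rcases rule_dichotomy (fun u hu => hu.2.2) hx hrule with ⟨m, hm, ⟨hmA, hmQ, -⟩, hfol⟩ | ⟨hnr, hfol⟩
  · have hg : ∀ n, T.Good k Q (x n) A (T.cone (x m)) := fun n =>
      good_play hx hA (answer_cone_play hx hm hmA hmQ) fun j _ _ => mem_cone_play hx m j
    refine exists_lift_of_good hσ hx hg (fun n hb => ?_) (fun _ => ?_) (fun h => ?_)
    · rcases le_or_gt n k with h | h
      · exact hlow' n h hb _ _
      · have hn : k + 2 ≤ n := by
          rcases eq_or_lt_of_le (Nat.succ_le_of_lt h) with h' | h'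
          · subst h'; simp [hk] at hb
          · exact h'
        rcases lt_or_ge n m with h' | h'
        · exact ev_cone hσ hx hn h' (hg n)
        · rw [hfol n h' hb, fixc_of_ch (ev_spec hσ (hg n)).1]
    · rw [hlow k le_rfl hk, ← hAdef]
    · simp [hk] at h
  · set B := (T.Reach false U)ᶜ ∩ (A ∩ {z | k + 2 ≤ T.lev z}) with hB
    have hAns : T.Answer k Q (x (k + 2)) A B := by
      refine ⟨⟨hnr _ (by omega), (hA.2 _ hA.1).1 (by simp [hx.lev, hk]) _ (hx.ch (k + 1)),
        (hx.lev (k + 2)).ge⟩, fun z hz hl => ?_, Or.inr ⟨fun z hz => ?_, fun z hz hb c hc hcA => ?_⟩⟩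
      · obtain ⟨hzr, hzA, -⟩ := hz
        cases hb : (T.lev z).bodd with
        | false =>
          obtain ⟨c, hc, hcA⟩ := (hA.2 z hzA).2
          exact ⟨c, hc, fun h => hzr (reach_of_ch hb hc h), hcA, by rw [Set.mem_ofPred_eq, hc.1]; omega⟩
        | true =>
          obtain ⟨c, hc, hcr⟩ := exists_ch_not_reach hzr
          exact ⟨c, hc, hcr, (hA.2 z hzA).1 hb c hc, by rw [Set.mem_ofPred_eq, hc.1]; omega⟩
      · by_contra hQ
        exact hz.1 (subset_reach ⟨hz.2.1, hQ, hz.2.2⟩)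
      · have hl : k + 2 ≤ T.lev z := hz.2.2
        exact ⟨fun h => hz.1 (reach_of_ch hb hc h), hcA, by rw [Set.mem_ofPred_eq, hc.1]; omega⟩
    have hmem : ∀ n, k + 2 ≤ n → ∀ m, k + 2 ≤ m → m ≤ n → x m ∈ B := by
      intro n hn
      induction n, hn using Nat.le_induction with
      | base =>
        intro m h1 h2
        obtain rfl : m = k + 2 := by omega
        exact hAns.1
      | succ n hn ih =>
        intro m h1 h2
        rcases eq_or_lt_of_le h2 with h | h
        · subst h
          refine ⟨hnr _ (by omega), ?_, by rw [Set.mem_ofPred_eq, hx.lev]; omega⟩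
          have hxn := ih n hn le_rfl
          cases hb : n.bodd with
          | true => exact (hA.2 _ hxn.2.1).1 (by rwa [hx.lev]) _ (hx.ch n)
          | false =>
            have hg := good_play hx hA hAns ih
            obtain ⟨e1, e2, e3, e4⟩ := ev_spec hσ hg
            have e5 := mem_of_good e2 (by rw [e1.1, hx.lev]; omega)
            rw [e4 (by rwa [hx.lev])] at e5
            rw [hfol n (by omega) hb, fixc_of_ch e1]
            exact e5.2.1
        · exact ih m h1 (by omega)
    have hg : ∀ n, T.Good k Q (x n) A B := fun n =>
      good_play hx hA hAns fun m h1 h2 => hmem n (by omega) m h1 h2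
    refine exists_lift_of_good hσ hx hg (fun n hb => ?_) (fun _ => ?_) (fun h => ?_)
    · rcases le_or_gt n k with h | h
      · exact hlow' n h hb _ _
      · rw [hfol n (by omega) hb, fixc_of_ch (ev_spec hσ (hg n)).1]
    · rw [hlow k le_rfl hk, ← hAdef]
    · simp [hk] at h

lemma lift_II (hσ : (T.unr k Q hk).IsStrat σ) {x : ℕ → T.N} (hx : T.IsPlay x)
    (hc : T.Cons true (T.φII k Q σ) x) :
    ∃ x', (T.unr k Q hk).IsPlay x' ∧ (T.unr k Q hk).Cons true σ x' ∧ ∀ n, (x' n).1.1 = x n := by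
  have hlow' : ∀ n, n ≤ k → n.bodd = true → ∀ A B : Set T.N,
      (T.ev k Q σ (x n) A B).1 = x (n + 1) := by
    intro n hn hb A B
    have h1 := hc n hb
    rw [φII, hx.lev, if_pos hn, fixc_of_ch (ev_spec hσ (good_low _ _ (by rwa [hx.lev]))).1] at h1
    have : T.lab k (x n) A B = T.lab k (x n) ∅ ∅ := by
      have h1 : n ≤ k + 1 := by omega
      simp [lab, hx.lev, hn, h1]
    rw [h1, ev_congr this]
  have hmid : ∀ A B : Set T.N, T.ev k Q σ (x (k + 1)) A B = T.ev k Q σ (x (k + 1)) A ∅ := by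
    intro A B
    have : T.lab k (x (k + 1)) A B = T.lab k (x (k + 1)) A ∅ := by
      simp [lab, hx.lev]
    exact ev_congr this
  have hgmid : ∀ A : Set T.N, T.QStrat (x (k + 1)) A → T.Good k Q (x (k + 1)) A ∅ := by
    intro A hA
    refine ⟨fun _ => ?_, fun h => ?_, fun m h1 h2 => ?_⟩
    · rwa [hx.anc le_rfl]
    · rw [hx.lev] at h; omega
    · rw [hx.lev] at h2; omega
  have hrule : ∀ n, k + 1 ≤ n → n.bodd = true → x (n + 1) =
      (let A := (T.Reach true (T.exits k Q σ (x (k + 1))))ᶜ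
      T.rule k Q σ true (T.exits k Q σ (x (k + 1))) (T.exitLab k Q σ (x (k + 1))) A
        (T.ev k Q σ (x (k + 1)) A ∅).2.2 (x n)) := by
    intro n hn hb
    rw [hc n hb, φII, hx.lev, if_neg (by omega), hx.anc (by omega)]
  have hk1 : (k + 1).bodd = true := by simp [hk]
  rcases rule_dichotomy (fun u hu => hu.choose_spec.2.2.2.1) hx hrule with
    ⟨m, hm, hmU, hfol⟩ | ⟨hnr, hfol⟩
  · obtain ⟨hA, hE⟩ : T.QStrat (x (k + 1)) (T.exitLab k Q σ (x (k + 1)) (x m)) ∧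
        T.Exit k Q (T.ev k Q σ (x (k + 1)) (T.exitLab k Q σ (x (k + 1)) (x m)) ∅).1
          (T.exitLab k Q σ (x (k + 1)) (x m))
          (T.ev k Q σ (x (k + 1)) (T.exitLab k Q σ (x (k + 1)) (x m)) ∅).2.2 (x m) := by
      rw [exitLab, dif_pos hmU]
      exact hmU.choose_spec
    generalize T.exitLab k Q σ (x (k + 1)) (x m) = A at hA hE hfol
    obtain ⟨hmA, hmQ, -, h2, h3⟩ := hE
    have hg : ∀ n, T.Good k Q (x n) A (T.cone (x m)) := fun n =>
      good_play hx hA (answer_cone_play hx hm hmA hmQ) fun j _ _ => mem_cone_play hx m j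
    refine exists_lift_of_good hσ hx hg (fun n hb => ?_) (fun h => ?_) (fun h => ?_)
    · rcases le_or_gt n k with h | h
      · exact hlow' n h hb _ _
      · rcases eq_or_lt_of_le (Nat.succ_le_of_lt h) with h' | h'
        · subst h'
          rw [hmid, ← h2, hx.anc hm]
        · rcases lt_or_ge n m with h'' | h''
          · exact ev_cone hσ hx h' h'' (hg n)
          · rw [hfol n h'' hb, fixc_of_ch (ev_spec hσ (hg n)).1]
    · simp [hk] at h
    · rw [hmid, h3]
  · set A := (T.Reach true (T.exits k Q σ (x (k + 1))))ᶜ with hAdef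
    have hA : T.QStrat (x (k + 1)) A := by
      refine ⟨hnr _ le_rfl, fun z hz => ⟨fun hb c hc h => hz (reach_of_ch hb hc h), ?_⟩⟩
      exact exists_ch_not_reach hz
    obtain ⟨e1, e2, e3, -⟩ := ev_spec hσ (hgmid A hA)
    rw [e3 (by rw [hx.lev])] at e2
    have hstep := hfol (k + 1) le_rfl hk1
    rw [hmid, fixc_of_ch e1] at hstep
    set B := (T.ev k Q σ (x (k + 1)) A ∅).2.2 with hB
    rw [← hstep] at e2
    have hAns : T.Answer k Q (x (k + 2)) A B := by
      have := e2.answer (by rw [hx.lev])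
      rwa [hx.anc le_rfl] at this
    have hStay : T.Stay Q A B := by
      refine hAns.2.2.resolve_left ?_
      rintro ⟨u, hu⟩
      refine hu.1 (subset_reach ⟨A, hA, ?_⟩)
      rw [← hstep]
      exact hu
    have hmem : ∀ n, k + 2 ≤ n → ∀ m, k + 2 ≤ m → m ≤ n → x m ∈ B := by
      intro n hn
      induction n, hn using Nat.le_induction with
      | base =>
        intro m h1 h2
        obtain rfl : m = k + 2 := by omega
        exact hAns.1
      | succ n hn ih =>
        intro m h1 h2
        rcases eq_or_lt_of_le h2 with h | h
        · subst h
          cases hb : n.bodd with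
          | false =>
            exact hStay.2 _ (ih n hn le_rfl) (by rwa [hx.lev]) _ (hx.ch n) (hnr _ (by omega))
          | true =>
            have hg := good_play hx hA hAns ih
            obtain ⟨e1, e2, e3, e4⟩ := ev_spec hσ hg
            have e5 := mem_of_good e2 (by rw [e1.1, hx.lev]; omega)
            rw [e4 (by rwa [hx.lev])] at e5
            rw [hfol n (by omega) hb, fixc_of_ch e1]
            exact e5
        · exact ih m h1 (by omega)
    have hg : ∀ n, T.Good k Q (x n) A B := fun n =>
      good_play hx hA hAns fun m h1 h2 => hmem n (by omega) m h1 h2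
    refine exists_lift_of_good hσ hx hg (fun n hb => ?_) (fun h => ?_) (fun h => ?_)
    · rcases le_or_gt n k with h | h
      · exact hlow' n h hb _ _
      · rw [hfol n (by omega) hb, fixc_of_ch (ev_spec hσ (hg n)).1]
    · simp [hk] at h
    · rw [hmid]

variable (T k Q hk) in
/-- The unravelling covering. -/
noncomputable def unrCov : Covering (T.unr k Q hk) T where
  π q := q.1.1
  lev_π _ := rfl
  par_π _ := rfl
  φ b σ := if b then T.φII k Q σ else T.φI k Q σ
  strat b σ _ z := by
    cases b
    · change T.Ch z (T.φI k Q σ z)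
      unfold φI
      split_ifs
      · exact ch_fixc _ _
      · exact ch_rule z
    · change T.Ch z (T.φII k Q σ z)
      unfold φII
      split_ifs
      · exact ch_fixc _ _
      · exact ch_rule z
  loc b n σ σ' _ _ ha z hz hb := by
    change {q // T.Legal k Q q} → {q // T.Legal k Q q} at σ σ'
    cases b
    · change T.φI k Q σ z = T.φI k Q σ' z
      unfold φI
      split_ifs with h
      · rw [ev_agree ha hz hb]
      · have hl : T.lev (T.anc z k) = k := lev_anc (by omega)
        rw [ev_agree ha (z := T.anc z k) (by omega) (by rw [hl, hk])]
        exact rule_congr ha hz hb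
    · change T.φII k Q σ z = T.φII k Q σ' z
      unfold φII
      split_ifs with h
      · rw [ev_agree ha hz hb]
      · have hl : T.lev (T.anc z (k + 1)) = k + 1 := lev_anc (by omega)
        have he : T.ev k Q σ (T.anc z (k + 1)) = T.ev k Q σ' (T.anc z (k + 1)) := by
          funext A B
          exact ev_agree ha (by omega) (by simp [hl, hk]) A B
        dsimp only
        rw [exitLab_congr he]
        simp only [exits, he]
        exact rule_congr ha hz hb
  lift b σ hσ x hx hc := by
    cases b
    · exact lift_I hσ hx hc
    · exact lift_II hσ hx hc

lemma isK_unrCov : (T.unrCov k Q hk).IsK k where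
  inj := by
    rintro ⟨q, hq⟩ ⟨q', hq'⟩ (hl : T.lev q.1 ≤ k) (h : q.1 = q'.1)
    apply Subtype.ext
    change q = q'
    have hl' : T.lev q'.1 ≤ k := h ▸ hl
    rw [eq_lab_of_legal hq (A := ∅) (B := ∅) (fun _ => by omega) (fun _ => by omega),
      eq_lab_of_legal hq' (A := ∅) (B := ∅) (fun _ => by omega) (fun _ => by omega), h]
  surj z hz := ⟨⟨_, legal_lab (good_low ∅ ∅ hz)⟩, rfl⟩
  strat_eq := by
    rintro b (σ : {q // T.Legal k Q q} → {q // T.Legal k Q q}) hσ ⟨q, hq⟩ (hl : T.lev q.1 < k) -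
    have hq' : q = T.lab k q.1 ∅ ∅ := eq_lab_of_legal hq (fun _ => by omega) (fun _ => by omega)
    have hg : T.Good k Q q.1 ∅ ∅ := good_low ∅ ∅ hl.le
    have he : T.ev k Q σ q.1 ∅ ∅ = (σ ⟨q, hq⟩).1 := by
      rw [ev_eq hg]
      congr 3
      exact hq'.symm
    have hs := ev_spec hσ hg
    cases b
    · change T.φI k Q σ q.1 = (σ ⟨q, hq⟩).1.1
      rw [φI, if_pos hl.le, fixc_of_ch hs.1, he]
    · change T.φII k Q σ q.1 = (σ ⟨q, hq⟩).1.1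
      rw [φII, if_pos hl.le, fixc_of_ch hs.1, he]

lemma unr_stay_iff {x : ℕ → {q // T.Legal k Q q}} (hx : (T.unr k Q hk).IsPlay x) :
    (x (k + 2)).1.2.2 ⊆ Q ↔ ∀ n, k + 2 ≤ n → (x n).1.1 ∈ Q := by
  have hp : T.IsPlay fun n => (x n).1.1 := (T.unrCov k Q hk).isPlay_π hx
  have hB : ∀ n, k + 2 ≤ n → (x n).1.2.2 = (x (k + 2)).1.2.2 := by
    intro n hn
    induction n, hn using Nat.le_induction with
    | base => rfl
    | succ n hn ih =>
      rw [← ih, ← (hx n).2]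
      change _ = if T.lev (T.par (x (n + 1)).1.1) ≤ k + 1 then ∅ else (x (n + 1)).1.2.2
      rw [if_neg]
      rw [(hp n).2, hp.lev]; omega
  have hmem : ∀ n, k + 2 ≤ n → (x n).1.1 ∈ (x (k + 2)).1.2.2 := fun n hn => by
    rw [← hB n hn]
    exact mem_of_good (x n).2.1 (by rw [hp.lev]; exact hn)
  refine ⟨fun h n hn => h (hmem n hn), fun h => ?_⟩
  have ha := (x (k + 2)).2.1.answer (by rw [hp.lev])
  rw [hp.anc le_rfl] at ha
  rcases ha.2.2 with ⟨u, -, huQ, hul, -, hu⟩ | h'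
  · exfalso
    have h1 := hmem _ hul
    rw [hu] at h1
    have h2 := h _ hul
    rcases h1 with h1 | h1
    · rw [hp.lev, anc_of_le le_rfl] at h1
      rw [← h1] at h2
      exact huQ h2
    · rw [anc_of_le (by rw [hp.lev])] at h1
      rw [h1] at h2
      exact huQ h2
  · exact h'.1

end UnravelCovering
end GTree

namespace GTree

section Borel

variable {T : GTree.{u}}

lemma Open.comap {T' : GTree.{u}} (c : Covering T' T) {Y : Set (ℕ → T.N)} (hY : T.Open Y) :
    T'.Open {x | (fun n => c.π (x n)) ∈ Y} := by
  intro x hx hxY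
  obtain ⟨n, hn⟩ := hY _ (c.isPlay_π hx) hxY
  exact ⟨n, fun x' hx' he => hn _ (c.isPlay_π hx') (congrArg c.π he)⟩

/-- Closed sets can be unravelled. -/
lemma exists_unravel_closed {Y : Set (ℕ → T.N)} (hY : T.Open Yᶜ) (k : ℕ) :
    ∃ (T' : GTree.{u}) (c : Covering T' T), c.IsK k ∧
      T'.Open {x | (fun n => c.π (x n)) ∈ Y} ∧ T'.Open {x | (fun n => c.π (x n)) ∉ Y} := by
  obtain ⟨l, hkl, hl⟩ : ∃ l, k ≤ l ∧ l.bodd = false := by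
    cases h : k.bodd with
    | false => exact ⟨k, le_rfl, h⟩
    | true => exact ⟨k + 1, by omega, by simp [h]⟩
  set Q : Set T.N := {z | ∃ x, T.IsPlay x ∧ x ∈ Y ∧ x (T.lev z) = z} with hQ
  have hmem : ∀ x, T.IsPlay x → (x ∈ Y ↔ ∀ n, l + 2 ≤ n → x n ∈ Q) := by
    refine fun x hx => ⟨fun h n _ => ⟨x, hx, h, by rw [hx.lev]⟩, fun h => ?_⟩
    by_contra hxY
    obtain ⟨n, hn⟩ := hY x hx hxY
    obtain ⟨x', hx', hx'Y, he⟩ := h (max n (l + 2)) (le_max_right _ _)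
    rw [hx.lev] at he
    refine hn x' hx' ?_ hx'Y
    rw [← hx'.anc (le_max_left n (l + 2)), he, hx.anc (le_max_left _ _)]
  have key : ∀ x, (T.unr l Q hl).IsPlay x →
      ((fun n => (T.unrCov l Q hl).π (x n)) ∈ Y ↔ (x (l + 2)).1.2.2 ⊆ Q) := fun x hx =>
    (hmem _ ((T.unrCov l Q hl).isPlay_π hx)).trans (unr_stay_iff hx).symm
  refine ⟨T.unr l Q hl, T.unrCov l Q hl, isK_unrCov.mono hkl, fun x hx h => ⟨l + 2, ?_⟩,
    fun x hx h => ⟨l + 2, ?_⟩⟩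
  · intro x' hx' he
    refine (key x' hx').2 ?_
    rw [he]
    exact (key x hx).1 h
  · intro x' hx' he h'
    refine h ((key x hx).2 ?_)
    rw [← he]
    exact (key x' hx').1 h'

variable {D : Type*} [TopologicalSpace D]

/-- `F` is continuous on the branches of `T`. -/
def ContF (T : GTree.{u}) (F : (ℕ → T.N) → D) : Prop := ∀ U, IsOpen U → T.Open (F ⁻¹' U)

/-- The pullbacks of `X` to trees can be unravelled. -/
def Unravelable (X : Set D) : Prop :=
  ∀ (T : GTree.{u}) (F : (ℕ → T.N) → D), T.ContF F → ∀ k,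
    ∃ (T' : GTree.{u}) (c : Covering T' T), c.IsK k ∧
      T'.Open {x | F (fun n => c.π (x n)) ∈ X} ∧ T'.Open {x | F (fun n => c.π (x n)) ∉ X}

lemma unravelable_of_isOpen {X : Set D} (hX : IsOpen X) : Unravelable.{u} X := by
  intro T F hF k
  obtain ⟨T', c, hk, h1, h2⟩ := T.exists_unravel_closed (Y := F ⁻¹' Xᶜ)
    (by rw [← Set.preimage_compl, compl_compl]; exact hF X hX) k
  refine ⟨T', c, hk, ?_, h1⟩
  simpa using h2

lemma Unravelable.compl {X : Set D} (hX : Unravelable.{u} X) : Unravelable.{u} Xᶜ := by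
  intro T F hF k
  obtain ⟨T', c, hk, h1, h2⟩ := hX T F hF k
  exact ⟨T', c, hk, h2, by simpa using h1⟩

open Covering in
lemma Unravelable.iUnion {X : ℕ → Set D} (hX : ∀ i, Unravelable.{u} (X i)) :
    Unravelable.{u} (⋃ i, X i) := by
  intro T F hF k
  let St := {s : Σ T : GTree.{u}, (ℕ → T.N) → D // s.1.ContF s.2}
  have hstep : ∀ (i : ℕ) (s : St), ∃ (s' : St) (c : Covering s'.1.1 s.1.1), c.IsK (k + i) ∧
      (∀ x, s'.1.2 x = s.1.2 fun n => c.π (x n)) ∧ s'.1.1.Open {x | s'.1.2 x ∈ X i} := by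
    rintro i ⟨⟨T, F⟩, hF⟩
    obtain ⟨T', c, hk, h1, -⟩ := hX i T F hF (k + i)
    exact ⟨⟨⟨T', fun x => F fun n => c.π (x n)⟩, fun U hU => (hF U hU).comap c⟩, c, hk,
      fun _ => rfl, h1⟩
  choose g c hK hF' hop using hstep
  let s : ℕ → St := fun i => Nat.rec ⟨⟨T, F⟩, hF⟩ g i
  let S : ℕ → GTree.{u} := fun i => (s i).1.1
  let cs : ∀ i, Covering (S (i + 1)) (S i) := fun i => c i (s i)
  have hKs : ∀ i, (cs i).IsK (k + i) := fun i => hK i (s i)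
  have hFL : ∀ (x : ℕ → LimN S cs) (i : ℕ),
      (s i).1.2 (fun n => (x n).1 i) = F fun n => (x n).1 0 := by
    intro x i
    induction i with
    | zero => rfl
    | succ i ih =>
      rw [← ih]
      refine (hF' i (s i) _).trans (congrArg (s i).1.2 (funext fun n => ?_))
      exact (x n).2 i
  have hopen : (limTree S cs k hKs).Open
      {x | F (fun n => (limCov S cs k hKs).π (x n)) ∈ ⋃ i, X i} := by
    intro x hx hxX
    obtain ⟨i, hi⟩ := Set.mem_iUnion.1 hxX
    obtain ⟨n, hn⟩ := hop i (s i) _ (isPlay_lim hKs hx (i + 1))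
      (Eq.mpr (congrArg (· ∈ X i) (hFL x (i + 1))) hi)
    refine ⟨n, fun x' hx' he => Set.mem_iUnion.2 ⟨i, ?_⟩⟩
    have := hn _ (isPlay_lim hKs hx' (i + 1)) (congrArg (fun z => z.1 (i + 1)) he)
    exact Eq.mp (congrArg (· ∈ X i) (hFL x' (i + 1))) this
  obtain ⟨T', c', hk', h1, h2⟩ := exists_unravel_closed
    (Y := {x | F (fun n => (limCov S cs k hKs).π (x n)) ∉ ⋃ i, X i})
    (by convert hopen using 1; ext x; simp) k
  refine ⟨T', (limCov S cs k hKs).comp c', IsK.comp (isK_limCov hKs) hk', ?_, h1⟩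
  convert h2 using 1
  ext x
  exact not_not.symm

lemma unravelable_of_measurableSet {X : Set D} (hX : @MeasurableSet D (borel D) X) :
    Unravelable.{u} X := by
  induction hX with
  | basic U hU => exact unravelable_of_isOpen hU
  | empty => exact unravelable_of_isOpen isOpen_empty
  | compl U _ ih => exact ih.compl
  | iUnion f _ ih => exact .iUnion ih

/-- Borel determinacy. -/
theorem borel_determined (hroot : ∀ x y : T.N, T.lev x = 0 → T.lev y = 0 → x = y)
    {F : (ℕ → T.N) → D} (hF : T.ContF F) {X : Set D} (hX : @MeasurableSet D (borel D) X) :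
    (∃ σ, T.IsStrat σ ∧ ∀ x, T.IsPlay x → T.Cons false σ x → F x ∈ X) ∨
    (∃ σ, T.IsStrat σ ∧ ∀ x, T.IsPlay x → T.Cons true σ x → F x ∉ X) := by
  obtain ⟨T', c, hk, h1, -⟩ := unravelable_of_measurableSet.{u} hX T F hF 0
  have hroot' : ∀ x y : T'.N, T'.lev x = 0 → T'.lev y = 0 → x = y := fun x y hx hy =>
    hk.inj x y hx.le (hroot _ _ (by rw [c.lev_π, hx]) (by rw [c.lev_π, hy]))
  rcases open_determined hroot' h1 with ⟨σ, hσ, h⟩ | ⟨σ, hσ, h⟩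
  · refine Or.inl ⟨_, c.strat false σ hσ, fun x hx hc => ?_⟩
    obtain ⟨x', hx', hc', he⟩ := c.lift false σ hσ x hx hc
    have := h x' hx' hc'
    rwa [Set.mem_ofPred_eq, funext he] at this
  · refine Or.inr ⟨_, c.strat true σ hσ, fun x hx hc => ?_⟩
    obtain ⟨x', hx', hc', he⟩ := c.lift true σ hσ x hx hc
    have := h x' hx' hc'
    rwa [Set.mem_ofPred_eq, funext he] at this

end Borel
end GTree

namespace SeqGame

variable {C : Type u}

lemma length_pre (p : ℕ → C) (n : ℕ) : (pre p n).length = n := by simp [pre]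

lemma pre_zero (p : ℕ → C) : pre p 0 = [] := by simp [pre]

lemma pre_succ (p : ℕ → C) (n : ℕ) : pre p (n + 1) = pre p n ++ [p n] := by
  rw [pre, List.ofFn_succ_last]
  rfl

lemma dropLast_pre_succ (p : ℕ → C) (n : ℕ) : (pre p (n + 1)).dropLast = pre p n := by
  rw [pre_succ, List.dropLast_concat]

lemma pre_eq_iff {p q : ℕ → C} {n : ℕ} : pre p n = pre q n ↔ ∀ i < n, p i = q i := by
  induction n with
  | zero => simp [pre]
  | succ n ih =>
    rw [pre_succ, pre_succ, ← List.concat_eq_append, ← List.concat_eq_append,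
      List.concat_inj, ih]
    exact ⟨fun h i hi => (Nat.lt_succ_iff_lt_or_eq.1 hi).elim (h.1 i) fun e => e ▸ h.2,
      fun h => ⟨fun i hi => h i (by omega), h n (by omega)⟩⟩

lemma pre_isPrefix_pre (p : ℕ → C) {m n : ℕ} (h : m ≤ n) : pre p m <+: pre p n := by
  induction n, h using Nat.le_induction with
  | base => exact List.prefix_rfl
  | succ n _ ih => exact ih.trans (by rw [pre_succ]; exact List.prefix_append _ _)

lemma exists_cylinder [TopologicalSpace C] [DiscreteTopology C] {U : Set (ℕ → C)}
    (hU : IsOpen U) {p : ℕ → C} (hp : p ∈ U) : ∃ n, ∀ q, pre q n = pre p n → q ∈ U := by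
  obtain ⟨V, ⟨x, n, rfl⟩, hpV, hVU⟩ :=
    (PiNat.isTopologicalBasis_cylinders fun _ : ℕ => C).exists_subset_of_mem_open hp hU
  refine ⟨n, fun q hq => hVU fun i hi => ?_⟩
  rw [pre_eq_iff.1 hq i hi]
  exact hpV i hi

/-- A nonempty pruned tree. -/
structure IsTree (T : Set (List C)) : Prop where
  nil : [] ∈ T
  pre : ∀ l l' : List C, l' ∈ T → l <+: l' → l ∈ T
  child : ∀ t ∈ T, ∃ c, t ++ [c] ∈ T

/-- The strategies in the tree `T`. -/
def IsStrat (T : Set (List C)) (s : List C → C) : Prop := ∀ t ∈ T, t ++ [s t] ∈ T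

section Encoding

variable (T own : Set (List C))

/-- The legal nodes of the alternating game in which player `false` only moves at the positions
in `own`, and player `true` at the other positions. -/
def Node (q : List C × ℕ) : Prop :=
  q.1 ∈ T ∧ (q.2 = 2 * q.1.length ∨ (q.2 = 2 * q.1.length + 1 ∧ q.1 ∉ own) ∨
    (q.2 + 1 = 2 * q.1.length ∧ q.1.dropLast ∈ own))

open Classical in
/-- The parent in the alternating game. -/
noncomputable def parent (q : List C × ℕ) : List C × ℕ :=
  (if (q.2 = 2 * q.1.length ∧ q.1.dropLast ∈ own) ∨ q.2 = 2 * q.1.length + 1 then q.1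
    else q.1.dropLast, q.2 - 1)

variable {T own}

lemma parent_keep {l : List C} {m : ℕ}
    (h : (m = 2 * l.length ∧ l.dropLast ∈ own) ∨ m = 2 * l.length + 1) :
    parent own (l, m) = (l, m - 1) := by
  rw [parent, if_pos h]

lemma parent_drop {l : List C} {m : ℕ} (h : m = 2 * l.length → l.dropLast ∉ own)
    (h' : m ≠ 2 * l.length + 1) : parent own (l, m) = (l.dropLast, m - 1) := by
  rw [parent, if_neg]
  rintro (h'' | h'')
  exacts [h h''.1 h''.2, h' h'']

lemma node_parent (hT : IsTree T) {q : List C × ℕ} (h : Node T own q) :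
    Node T own (parent own q) := by
  obtain ⟨l, m⟩ := q
  obtain ⟨hl, h⟩ := h
  have hd : l.dropLast ∈ T := hT.pre _ _ hl (List.dropLast_prefix l)
  rcases eq_or_ne l [] with rfl | hne
  · simp only [List.length_nil] at h
    simp only [Node, parent, List.dropLast_nil, ite_self, List.length_nil]
    exact ⟨hl, Or.inl (by omega)⟩
  have hlen := List.length_pos_of_ne_nil hne
  simp only [Node, parent] at h ⊢
  rcases h with h | ⟨h, ho⟩ | ⟨h, ho⟩
  · by_cases ho : l.dropLast ∈ own
    · rw [if_pos (Or.inl ⟨h, ho⟩)]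
      exact ⟨hl, Or.inr (Or.inr ⟨by omega, ho⟩)⟩
    · rw [if_neg (by rintro (h' | h'); exacts [ho h'.2, by omega])]
      exact ⟨hd, Or.inr (Or.inl ⟨by rw [List.length_dropLast]; omega, ho⟩)⟩
  · rw [if_pos (Or.inr h)]
    exact ⟨hl, Or.inl (by omega)⟩
  · rw [if_neg (by omega)]
    exact ⟨hd, Or.inl (by rw [List.length_dropLast]; omega)⟩

lemma exists_node_child (hT : IsTree T) {q : List C × ℕ} (h : Node T own q) :
    ∃ q', Node T own q' ∧ q'.2 = q.2 + 1 ∧ parent own q' = q := by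
  obtain ⟨l, m⟩ := q
  obtain ⟨hl, h⟩ := h
  simp only at h
  obtain ⟨c, hc⟩ := hT.child l hl
  rcases h with h | ⟨h, ho⟩ | ⟨h, ho⟩
  · by_cases ho : l ∈ own
    · refine ⟨(l ++ [c], m + 1), ⟨hc, Or.inr (Or.inr ⟨?_, ?_⟩)⟩, rfl, ?_⟩
      · simp only [List.length_append, List.length_singleton]; omega
      · simpa using ho
      · rw [parent, if_neg (by simp only [List.length_append, List.length_singleton]; omega)]
        simp
    · refine ⟨(l, m + 1), ⟨hl, Or.inr (Or.inl ⟨by simp only; omega, ho⟩)⟩, rfl, ?_⟩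
      rw [parent, if_pos (Or.inr (by simp only; omega))]
      simp
  · refine ⟨(l ++ [c], m + 1), ⟨hc, Or.inl ?_⟩, rfl, ?_⟩
    · simp only [List.length_append, List.length_singleton]; omega
    · rw [parent, if_neg (by
        simp only [List.length_append, List.length_singleton, List.dropLast_concat]
        rintro (h' | h')
        exacts [ho h'.2, by omega])]
      simp
  · refine ⟨(l, m + 1), ⟨hl, Or.inl (by simp only; omega)⟩, rfl, ?_⟩
    rw [parent, if_pos (Or.inl ⟨by simp only; omega, ho⟩)]
    simp

variable (own) in
/-- The tree of the alternating game. -/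
noncomputable def altTree (hT : IsTree T) : GTree.{u} where
  N := {q : List C × ℕ // Node T own q}
  lev q := q.1.2
  par q := ⟨parent own q.1, node_parent hT q.2⟩
  lev_par _ := rfl
  exists_child q := by
    obtain ⟨q', h1, h2, h3⟩ := exists_node_child hT q.2
    exact ⟨⟨q', h1⟩, h2, Subtype.ext h3⟩

variable {hT : IsTree T}

lemma ch_even {q q' : {q : List C × ℕ // Node T own q}} (h : (altTree own hT).Ch q q')
    (hq : q.1.2 = 2 * q.1.1.length) :
    (q.1.1 ∈ own → ∃ c, q'.1.1 = q.1.1 ++ [c]) ∧ (q.1.1 ∉ own → q'.1.1 = q.1.1) := by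
  obtain ⟨⟨l, m⟩, hn⟩ := q
  obtain ⟨⟨l', m'⟩, hl', hn'⟩ := q'
  obtain ⟨h1 : m' = m + 1, h2⟩ := h
  have h3 : (parent own (l', m')).1 = l := congrArg (fun x => x.1.1) h2
  simp only at hq hn' ⊢
  rcases hn' with h | ⟨h, ho⟩ | ⟨h, ho⟩
  · omega
  · rw [parent_keep (Or.inr h)] at h3
    subst h3
    exact ⟨fun h' => absurd h' ho, fun _ => rfl⟩
  · rw [parent_drop (by omega) (by omega)] at h3
    subst h3
    have : l' ≠ [] := by rintro rfl; simp at h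
    exact ⟨fun _ => ⟨l'.getLast this, (List.dropLast_append_getLast this).symm⟩,
      fun h' => absurd ho h'⟩

lemma ch_odd {q q' : {q : List C × ℕ // Node T own q}} (h : (altTree own hT).Ch q q') :
    (q.1.2 = 2 * q.1.1.length + 1 → ∃ c, q'.1.1 = q.1.1 ++ [c]) ∧
    (q.1.2 + 1 = 2 * q.1.1.length → q'.1.1 = q.1.1) := by
  obtain ⟨⟨l, m⟩, hn⟩ := q
  obtain ⟨⟨l', m'⟩, hl', hn'⟩ := q'
  obtain ⟨h1 : m' = m + 1, h2⟩ := h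
  have h3 : (parent own (l', m')).1 = l := congrArg (fun x => x.1.1) h2
  simp only at hn' ⊢
  refine ⟨fun hq => ?_, fun hq => ?_⟩
  · have hne : l' ≠ [] := by rintro rfl; simp at hn'; omega
    have hm : m' = 2 * l'.length := by omega
    by_cases ho : l'.dropLast ∈ own
    · rw [parent_keep (Or.inl ⟨hm, ho⟩)] at h3
      replace h3 : l' = l := h3
      subst h3
      omega
    · rw [parent_drop (fun _ => ho) (by omega)] at h3
      subst h3
      exact ⟨l'.getLast hne, (List.dropLast_append_getLast hne).symm⟩
  · have hm : m' = 2 * l'.length := by omega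
    by_cases ho : l'.dropLast ∈ own
    · rw [parent_keep (Or.inl ⟨hm, ho⟩)] at h3
      exact h3
    · rw [parent_drop (fun _ => ho) (by omega)] at h3
      subst h3
      rw [List.length_dropLast] at hq
      omega

lemma length_of_even {x : ℕ → {q : List C × ℕ // Node T own q}}
    (hx : (altTree own hT).IsPlay x) (n : ℕ) : (x (2 * n)).1.1.length = n := by
  have h1 : (x (2 * n)).1.2 = 2 * n := hx.lev _
  have h2 := (x (2 * n)).2.2
  omega

lemma dropLast_even {x : ℕ → {q : List C × ℕ // Node T own q}}
    (hx : (altTree own hT).IsPlay x) (n : ℕ) :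
    (x (2 * (n + 1))).1.1.dropLast = (x (2 * n)).1.1 := by
  have h0 : (x (2 * n)).1.2 = 2 * n := hx.lev _
  have h0' : (x (2 * n + 1)).1.2 = 2 * n + 1 := hx.lev _
  have hl := length_of_even hx n
  have h1 := ch_even (hx.ch (2 * n)) (by rw [hl, h0])
  have h2 := ch_odd (hx.ch (2 * n + 1))
  rw [show 2 * (n + 1) = 2 * n + 1 + 1 by ring]
  by_cases ho : (x (2 * n)).1.1 ∈ own
  · obtain ⟨c, hc⟩ := h1.1 ho
    rw [h2.2 (by rw [h0', hc]; simp [hl]; ring), hc, List.dropLast_concat]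
  · have hc := h1.2 ho
    obtain ⟨c, hc'⟩ := h2.1 (by rw [h0', hc, hl])
    rw [hc', hc, List.dropLast_concat]

/-- The sequence of choices of a branch of the alternating game. -/
def out (c₀ : C) (x : ℕ → {q : List C × ℕ // Node T own q}) (n : ℕ) : C :=
  (x (2 * (n + 1))).1.1.getLastD c₀

lemma pre_out (c₀ : C) {x : ℕ → {q : List C × ℕ // Node T own q}}
    (hx : (altTree own hT).IsPlay x) (n : ℕ) : pre (out c₀ x) n = (x (2 * n)).1.1 := by
  induction n with
  | zero => rw [pre_zero]; exact (List.eq_nil_of_length_eq_zero (length_of_even hx 0)).symm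
  | succ n ih =>
    have hne : (x (2 * (n + 1))).1.1 ≠ [] :=
      List.ne_nil_of_length_pos (by rw [length_of_even hx]; omega)
    rw [pre_succ, ih, ← dropLast_even hx, out, List.getLastD_eq_getLast?,
      List.getLast?_eq_some_getLast hne]
    exact List.dropLast_append_getLast hne

variable (own) in
open Classical in
/-- The branch of the alternating game given by a sequence of choices. -/
noncomputable def pos (p : ℕ → C) (m : ℕ) : List C × ℕ :=
  (if m.bodd ∧ pre p (m / 2) ∉ own then pre p (m / 2) else pre p ((m + 1) / 2), m)

lemma pos_even (p : ℕ → C) (n : ℕ) : pos own p (2 * n) = (pre p n, 2 * n) := by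
  rw [pos, if_neg (by simp), show (2 * n + 1) / 2 = n by omega]

lemma pos_odd_of_mem {p : ℕ → C} {n : ℕ} (h : pre p n ∈ own) :
    pos own p (2 * n + 1) = (pre p (n + 1), 2 * n + 1) := by
  rw [pos, show (2 * n + 1) / 2 = n by omega, show (2 * n + 1 + 1) / 2 = n + 1 by omega,
    if_neg (fun h' => h'.2 h)]

lemma pos_odd_of_notMem {p : ℕ → C} {n : ℕ} (h : pre p n ∉ own) :
    pos own p (2 * n + 1) = (pre p n, 2 * n + 1) := by
  rw [pos, show (2 * n + 1) / 2 = n by omega, if_pos ⟨by simp, h⟩]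

lemma node_pos {p : ℕ → C} (hp : ∀ n, pre p n ∈ T) (m : ℕ) : Node T own (pos own p m) := by
  obtain ⟨n, rfl | rfl⟩ := m.even_or_odd'
  · rw [pos_even]
    exact ⟨hp n, Or.inl (by simp only [length_pre])⟩
  · by_cases h : pre p n ∈ own
    · rw [pos_odd_of_mem h]
      exact ⟨hp _, Or.inr (Or.inr ⟨by simp only [length_pre]; ring, by rwa [dropLast_pre_succ]⟩)⟩
    · rw [pos_odd_of_notMem h]
      exact ⟨hp n, Or.inr (Or.inl ⟨by simp only [length_pre], h⟩)⟩

lemma isPlay_pos {p : ℕ → C} (hp : ∀ n, pre p n ∈ T) :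
    (altTree own hT).IsPlay fun m => ⟨pos own p m, node_pos hp m⟩ := by
  refine fun m => ⟨rfl, Subtype.ext ?_⟩
  change parent own (pos own p (m + 1)) = pos own p m
  obtain ⟨n, rfl | rfl⟩ := m.even_or_odd'
  · rw [pos_even]
    by_cases h : pre p n ∈ own
    · rw [pos_odd_of_mem h, parent_drop (by rw [length_pre]; omega) (by rw [length_pre]; omega),
        dropLast_pre_succ]
      rfl
    · rw [pos_odd_of_notMem h, parent_keep (Or.inr (by rw [length_pre]))]
      rfl
  · rw [show 2 * n + 1 + 1 = 2 * (n + 1) by ring, pos_even]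
    by_cases h : pre p n ∈ own
    · rw [pos_odd_of_mem h, parent_keep
        (Or.inl ⟨by rw [length_pre], by rwa [dropLast_pre_succ]⟩)]
      rfl
    · rw [pos_odd_of_notMem h, parent_drop (fun _ => by rwa [dropLast_pre_succ])
        (by rw [length_pre]; omega), dropLast_pre_succ]
      rfl

lemma out_pos (c₀ : C) {p : ℕ → C} (hp : ∀ n, pre p n ∈ T) :
    out (own := own) c₀ (fun m => ⟨pos own p m, node_pos hp m⟩) = p := by
  funext n
  simp only [out, pos_even, pre_succ]
  simp

variable [TopologicalSpace C] [DiscreteTopology C]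

lemma contF_out (c₀ : C) : (altTree own hT).ContF (out c₀) := by
  intro U hU x hx hxU
  obtain ⟨n, hn⟩ := exists_cylinder hU hxU
  refine ⟨2 * n, fun x' hx' he => hn _ ?_⟩
  rw [pre_out c₀ hx, pre_out c₀ hx', he]

/-- Player `own` (choosing at the positions in `own`) or the opponents can force the outcome of
a Borel game. -/
lemma exists_strategy (hT : IsTree T) {X : Set (ℕ → C)}
    (hX : @MeasurableSet _ (borel (ℕ → C)) X) :
    (∃ s, IsStrat T s ∧ ∀ p, (∀ n, pre p n ∈ T) →
      (∀ n, pre p n ∈ own → p n = s (pre p n)) → p ∈ X) ∨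
    (∃ s, IsStrat T s ∧ ∀ p, (∀ n, pre p n ∈ T) →
      (∀ n, pre p n ∉ own → p n = s (pre p n)) → p ∉ X) := by
  classical
  obtain ⟨c₀, -⟩ := hT.child _ hT.nil
  have hroot : ∀ x y : (altTree own hT).N, (altTree own hT).lev x = 0 →
      (altTree own hT).lev y = 0 → x = y := by
    rintro ⟨⟨l, m⟩, -, h⟩ ⟨⟨l', m'⟩, -, h'⟩ (rfl : m = 0) (rfl : m' = 0)
    have h1 : l = [] := List.eq_nil_of_length_eq_zero (by
      rcases h with h | h | ⟨h, -⟩ <;> simp only at h <;> omega)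
    have h2 : l' = [] := List.eq_nil_of_length_eq_zero (by
      rcases h' with h | h | ⟨h, -⟩ <;> simp only at h <;> omega)
    subst h1 h2
    rfl
  rcases GTree.borel_determined hroot (contF_out c₀) hX with ⟨σ, hσ, h⟩ | ⟨σ, hσ, h⟩
  · left
    have : ∀ t, ∃ c, t ∈ T → t ++ [c] ∈ T ∧
        ∀ hn : Node T own (t, 2 * t.length), t ∈ own → (σ ⟨_, hn⟩).1.1 = t ++ [c] := by
      intro t
      by_cases ht : t ∈ T
      · have hn : Node T own (t, 2 * t.length) := ⟨ht, Or.inl rfl⟩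
        by_cases ho : t ∈ own
        · obtain ⟨c, hc⟩ := (ch_even (hσ ⟨_, hn⟩) rfl).1 ho
          exact ⟨c, fun _ => ⟨hc ▸ (σ ⟨_, hn⟩).2.1, fun _ _ => hc⟩⟩
        · obtain ⟨c, hc⟩ := hT.child t ht
          exact ⟨c, fun _ => ⟨hc, fun _ h => absurd h ho⟩⟩
      · exact ⟨c₀, fun h => absurd h ht⟩
    choose s hs using this
    refine ⟨s, fun t ht => (hs t ht).1, fun p hp hc => ?_⟩
    rw [← out_pos (own := own) c₀ hp]
    refine h _ (isPlay_pos hp) fun m hm => ?_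
    obtain ⟨n, rfl | rfl⟩ := m.even_or_odd'
    · have hn : Node T own (pre p n, 2 * n) := pos_even (own := own) p n ▸ node_pos hp (2 * n)
      have he : (⟨pos own p (2 * n), node_pos hp (2 * n)⟩ : {q // Node T own q}) =
          ⟨(pre p n, 2 * n), hn⟩ := Subtype.ext (pos_even p n)
      rw [he]
      have hch := hσ ⟨(pre p n, 2 * n), hn⟩
      refine Subtype.ext (Prod.ext ?_ hch.1.symm)
      by_cases ho : pre p n ∈ own
      · have := (hs _ (hp n)).2 (by rwa [length_pre]) ho
        simp only [length_pre] at this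
        refine Eq.trans ?_ this.symm
        change (pos own p (2 * n + 1)).1 = _
        rw [pos_odd_of_mem ho, pre_succ, hc n ho]
      · refine Eq.trans ?_ ((ch_even hch (by simp only [length_pre])).2 ho).symm
        change (pos own p (2 * n + 1)).1 = _
        rw [pos_odd_of_notMem ho]
    · simp at hm
  · right
    have : ∀ t, ∃ c, t ∈ T → t ++ [c] ∈ T ∧
        ∀ hn : Node T own (t, 2 * t.length + 1), (σ ⟨_, hn⟩).1.1 = t ++ [c] := by
      intro t
      by_cases ht : t ∈ T
      · by_cases hn : Node T own (t, 2 * t.length + 1)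
        · obtain ⟨c, hc⟩ := (ch_odd (hσ ⟨_, hn⟩)).1 rfl
          exact ⟨c, fun _ => ⟨hc ▸ (σ ⟨_, hn⟩).2.1, fun _ => hc⟩⟩
        · obtain ⟨c, hc⟩ := hT.child t ht
          exact ⟨c, fun _ => ⟨hc, fun h => absurd h hn⟩⟩
      · exact ⟨c₀, fun h => absurd h ht⟩
    choose s hs using this
    refine ⟨s, fun t ht => (hs t ht).1, fun p hp hc => ?_⟩
    rw [← out_pos (own := own) c₀ hp]
    refine h _ (isPlay_pos hp) fun m hm => ?_
    obtain ⟨n, rfl | rfl⟩ := m.even_or_odd'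
    · simp at hm
    · have hch := hσ ⟨pos own p (2 * n + 1), node_pos hp (2 * n + 1)⟩
      refine Subtype.ext (Prod.ext ?_ hch.1.symm)
      change (pos own p (2 * (n + 1))).1 = _
      rw [pos_even]
      by_cases ho : pre p n ∈ own
      · refine Eq.trans ?_ (Eq.symm ((ch_odd hch).2 ?_))
        · change _ = (pos own p (2 * n + 1)).1
          rw [pos_odd_of_mem ho]
        · change (pos own p (2 * n + 1)).2 + 1 = 2 * (pos own p (2 * n + 1)).1.length
          rw [pos_odd_of_mem ho, length_pre]
          ring
      · have hn : Node T own (pre p n, 2 * n + 1) :=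
          pos_odd_of_notMem ho ▸ node_pos hp (2 * n + 1)
        have he : (⟨pos own p (2 * n + 1), node_pos hp (2 * n + 1)⟩ : {q // Node T own q}) =
            ⟨(pre p n, 2 * n + 1), hn⟩ := Subtype.ext (pos_odd_of_notMem ho)
        rw [he]
        have := (hs _ (hp n)).2 (by rwa [length_pre])
        simp only [length_pre] at this
        rw [this, pre_succ, hc n ho]

end Encoding

/-- The player choosing at the positions in `own` can force the outcome `X` from `γ` on. -/
def Force (T own : Set (List C)) (γ : List C) (X : Set (ℕ → C)) : Prop :=
  ∃ s, IsStrat T s ∧ ∀ p, (∀ n, pre p n ∈ T) → pre p γ.length = γ →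
    (∀ n, γ.length ≤ n → pre p n ∈ own → p n = s (pre p n)) → p ∈ X

lemma prefix_or_of_pre {p : ℕ → C} {γ : List C} (h : pre p γ.length = γ) (n : ℕ) :
    pre p n <+: γ ∨ γ <+: pre p n := by
  rw [← h]
  exact (le_total n γ.length).imp (pre_isPrefix_pre p) (pre_isPrefix_pre p)

lemma isTree_comparable {T : Set (List C)} (hT : IsTree T) {γ : List C} (hγ : γ ∈ T) :
    IsTree {t ∈ T | t <+: γ ∨ γ <+: t} where
  nil := ⟨hT.nil, Or.inl ⟨γ, rfl⟩⟩
  pre l l' h hl := ⟨hT.pre l l' h.1 hl, h.2.elim (fun h' => Or.inl (hl.trans h'))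
    fun h' => List.prefix_or_prefix_of_prefix hl h'⟩
  child t ht := by
    obtain ⟨ht, h⟩ := ht
    by_cases h' : γ <+: t
    · obtain ⟨c, hc⟩ := hT.child t ht
      exact ⟨c, hc, Or.inr (h'.trans (List.prefix_append _ _))⟩
    · obtain ⟨u, rfl⟩ := h.resolve_right h'
      cases u with
      | nil => simp at h'
      | cons c u =>
        have : t ++ [c] <+: t ++ c :: u := ⟨u, by simp⟩
        exact ⟨c, hT.pre _ _ hγ this, Or.inl this⟩

lemma force_of_comparable {T own : Set (List C)} (hT : IsTree T) {γ : List C}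
    {X : Set (ℕ → C)} {s : List C → C} (hs : IsStrat {t ∈ T | t <+: γ ∨ γ <+: t} s)
    (h : ∀ p, (∀ n, pre p n ∈ {t ∈ T | t <+: γ ∨ γ <+: t}) →
      (∀ n, pre p n ∈ own → p n = s (pre p n)) → p ∈ X) : Force T own γ X := by
  classical
  have : ∀ t, ∃ c, (t ∈ T → t ++ [c] ∈ T) ∧ (γ <+: t → c = s t) := by
    intro t
    by_cases ht : t ∈ T
    · by_cases hγt : γ <+: t
      · exact ⟨s t, fun _ => (hs t ⟨ht, Or.inr hγt⟩).1, fun _ => rfl⟩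
      · obtain ⟨c, hc⟩ := hT.child t ht
        exact ⟨c, fun _ => hc, fun h' => absurd h' hγt⟩
    · exact ⟨s t, fun h' => absurd h' ht, fun _ => rfl⟩
  choose s' hs' using this
  refine ⟨s', fun t ht => (hs' t).1 ht, fun p hp hpγ hc => h p
    (fun n => ⟨hp n, prefix_or_of_pre hpγ n⟩) fun n hn => ?_⟩
  rcases le_or_gt γ.length n with hle | hlt
  · rw [hc n hle hn]
    refine (hs' _).2 ?_
    have := pre_isPrefix_pre p hle
    rwa [hpγ] at this
  · have h1 := (hs (pre p n) ⟨hp n, prefix_or_of_pre hpγ n⟩).2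
    have h2 : pre p n ++ [s (pre p n)] <+: γ := by
      refine h1.elim id fun h1 => ?_
      rw [h1.eq_of_length_le (by simpa [length_pre] using hlt)]
    have h3 : pre p n ++ [p n] <+: γ := by
      rw [← pre_succ]
      have := pre_isPrefix_pre p (Nat.succ_le_of_lt hlt)
      rwa [hpγ] at this
    have h4 := (List.prefix_of_prefix_length_le h3 h2 (by simp)).eq_of_length (by simp)
    simpa using h4

/-- Borel determinacy in the subtree of the nodes comparable with `γ`. -/
lemma force_or_force [TopologicalSpace C] [DiscreteTopology C] {T : Set (List C)}
    (own : Set (List C)) (hT : IsTree T) {γ : List C} (hγ : γ ∈ T) {X : Set (ℕ → C)}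
    (hX : @MeasurableSet _ (borel (ℕ → C)) X) : Force T own γ X ∨ Force T ownᶜ γ Xᶜ := by
  rcases exists_strategy (own := own) (isTree_comparable hT hγ) hX with ⟨s, hs, h⟩ | ⟨s, hs, h⟩
  · exact Or.inl (force_of_comparable hT hs h)
  · exact Or.inr (force_of_comparable hT hs h)

end SeqGame

namespace SeqGame

variable {C : Type u} {O : Type*}

lemma take_pre (p : ℕ → C) {k n : ℕ} (h : k ≤ n) : (pre p n).take k = pre p k := by
  have h1 := List.prefix_iff_eq_take.1 (pre_isPrefix_pre p h)
  rw [length_pre] at h1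
  exact h1.symm

lemma exists_first_ne {p q : ℕ → C} (h : p ≠ q) : ∃ m, pre q m = pre p m ∧ q m ≠ p m := by
  classical
  have hex : ∃ m, q m ≠ p m := by
    by_contra! h'
    exact h (funext fun m => (h' m).symm)
  exact ⟨Nat.find hex, pre_eq_iff.2 fun i hi => not_not.1 (Nat.find_min hex hi),
    Nat.find_spec hex⟩

lemma pre_play (s : List C → C) (γ : List C) (n : ℕ) : pre (play s γ) n = hist s γ n := by
  induction n with
  | zero => rw [pre_zero, hist]
  | succ n ih =>
    rw [pre_succ, ih, hist]
    rfl

lemma play_of_le (s : List C → C) (γ : List C) {n : ℕ} (h : γ.length ≤ n) :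
    play s γ n = s (pre (play s γ) n) := by
  rw [pre_play, play, dif_neg (by omega)]

lemma pre_play_length (s : List C → C) (γ : List C) : pre (play s γ) γ.length = γ := by
  refine List.ext_getElem (length_pre _ _) fun i h1 h2 => ?_
  simp [pre, play]

lemma mem_of_step {T : Set (List C)} (hT : IsTree T) {γ : List C} (hγ : γ ∈ T) {p : ℕ → C}
    (hp : pre p γ.length = γ)
    (h : ∀ n, γ.length ≤ n → pre p n ∈ T → pre p n ++ [p n] ∈ T) (n : ℕ) : pre p n ∈ T := by
  rcases le_total n γ.length with hn | hn
  · exact hT.pre _ _ hγ (hp ▸ pre_isPrefix_pre p hn)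
  · induction n, hn using Nat.le_induction with
    | base => rwa [hp]
    | succ n hn ih => rw [pre_succ]; exact h n hn ih

lemma play_mem {T : Set (List C)} (hT : IsTree T) {s : List C → C} (hs : IsStrat T s)
    {γ : List C} (hγ : γ ∈ T) (n : ℕ) : pre (play s γ) n ∈ T :=
  mem_of_step hT hγ (pre_play_length s γ)
    (fun n hn h => by rw [play_of_le s γ hn]; exact hs _ h) n

lemma exists_play_of_both {T : Set (List C)} (own : Set (List C)) (hT : IsTree T)
    {s t : List C → C} (hs : IsStrat T s) (ht : IsStrat T t) {γ : List C} (hγ : γ ∈ T) :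
    ∃ q : ℕ → C, (∀ n, pre q n ∈ T) ∧ pre q γ.length = γ ∧ ∀ n, γ.length ≤ n →
      (pre q n ∈ own → q n = s (pre q n)) ∧ (pre q n ∉ own → q n = t (pre q n)) := by
  classical
  let g : List C → C := fun l => if l ∈ own then s l else t l
  have hg : IsStrat T g := fun l hl => by
    by_cases h : l ∈ own
    · simpa only [g, if_pos h] using hs l hl
    · simpa only [g, if_neg h] using ht l hl
  refine ⟨play g γ, play_mem hT hg hγ, pre_play_length g γ, fun n hn => ⟨fun h => ?_, fun h => ?_⟩⟩
  · rw [play_of_le g γ hn]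
    simp only [g, if_pos h]
  · rw [play_of_le g γ hn]
    simp only [g, if_neg h]

/-- The outcomes that the player choosing in `own` can strictly beat from `γ` on. -/
def Val (T own : Set (List C)) (v : (ℕ → C) → O) (r : O → O → Prop) (γ : List C) : Set O :=
  {x | Force T own γ {p | r x (v p)}}

section Value

variable {T own : Set (List C)} {v : (ℕ → C) → O} {r : O → O → Prop}

lemma val_lower (hr : SWO r) {γ : List C} {x y : O} (hx : x ∈ Val T own v r γ)
    (h : ¬ r x y) : y ∈ Val T own v r γ := by
  obtain ⟨s, hs, hf⟩ := hx
  refine ⟨s, hs, fun p h1 h2 h3 => ?_⟩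
  by_contra h'
  exact hr.2.2 x y (v p) h h' (hf p h1 h2 h3)

lemma val_total (hr : SWO r) (γ γ' : List C) :
    Val T own v r γ ⊆ Val T own v r γ' ∨ Val T own v r γ' ⊆ Val T own v r γ := by
  by_contra! h
  obtain ⟨x, hx, hx'⟩ := Set.not_subset.1 h.1
  obtain ⟨y, hy, hy'⟩ := Set.not_subset.1 h.2
  have h1 : r x y := by
    by_contra h1
    exact hy' (val_lower hr hx h1)
  have h2 : r y x := by
    by_contra h2
    exact hx' (val_lower hr hy h2)
  exact hr.1 x (hr.2.1 _ _ _ h1 h2)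

lemma pre_concat_length {p : ℕ → C} {γ : List C} {c : C} (h : pre p γ.length = γ)
    (hc : p γ.length = c) : pre p (γ ++ [c]).length = γ ++ [c] := by
  rw [List.length_append, List.length_singleton, pre_succ, h, hc]

lemma of_pre_concat {p : ℕ → C} {γ : List C} {c : C}
    (h : pre p (γ ++ [c]).length = γ ++ [c]) : pre p γ.length = γ ∧ p γ.length = c := by
  rw [List.length_append, List.length_singleton, pre_succ] at h
  have := List.append_inj h (length_pre _ _)
  exact ⟨this.1, by simpa using this.2⟩

lemma val_child_subset {γ : List C} {c : C} (hγ : γ ∈ own) (hc : γ ++ [c] ∈ T) :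
    Val T own v r (γ ++ [c]) ⊆ Val T own v r γ := by
  classical
  rintro x ⟨s, hs, h⟩
  refine ⟨fun t => if t = γ then c else s t, fun t ht => ?_, fun p h1 h2 h3 => ?_⟩
  · by_cases h' : t = γ
    · simpa only [h', if_true] using hc
    · simpa only [if_neg h'] using hs t ht
  · refine h p h1 (pre_concat_length h2 ?_) fun n hn ho => ?_
    · rw [h3 _ le_rfl (by rwa [h2]), h2]
      exact if_pos rfl
    · rw [List.length_append, List.length_singleton] at hn
      rw [h3 n (by omega) ho]
      refine if_neg fun h' => ?_
      have := congrArg List.length h'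
      rw [length_pre] at this
      omega

lemma val_subset_child {γ : List C} {c : C} (hγ : γ ∉ own) :
    Val T own v r γ ⊆ Val T own v r (γ ++ [c]) := by
  rintro x ⟨s, hs, h⟩
  refine ⟨s, hs, fun p h1 h2 h3 => ?_⟩
  obtain ⟨h4, h5⟩ := of_pre_concat h2
  refine h p h1 h4 fun n hn ho => ?_
  rcases hn.eq_or_lt with rfl | hn
  · rw [h4] at ho
    exact absurd ho hγ
  · exact h3 n (by simpa using hn) ho

lemma exists_mem_val_child {γ : List C} (hγ : γ ∈ T) {x : O}
    (hx : x ∈ Val T own v r γ) : ∃ c, γ ++ [c] ∈ T ∧ x ∈ Val T own v r (γ ++ [c]) := by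
  obtain ⟨s, hs, h⟩ := hx
  refine ⟨s γ, hs γ hγ, s, hs, fun p h1 h2 h3 => ?_⟩
  obtain ⟨h4, h5⟩ := of_pre_concat h2
  refine h p h1 h4 fun n hn ho => ?_
  rcases hn.eq_or_lt with rfl | hn
  · rw [h4, h5]
  · exact h3 n (by simpa using hn) ho

lemma exists_val_subset_child (hT : IsTree T) (hr : SWO r) {γ : List C} (hγ : γ ∈ T)
    (hfin : {c | γ ++ [c] ∈ T}.Finite) :
    ∃ c, γ ++ [c] ∈ T ∧ Val T own v r γ ⊆ Val T own v r (γ ++ [c]) := by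
  obtain ⟨c, hc, hmax⟩ := hfin.exists_maximalFor (fun c => Val T own v r (γ ++ [c])) _
    (hT.child γ hγ)
  refine ⟨c, hc, fun x hx => ?_⟩
  obtain ⟨c', hc', hx'⟩ := exists_mem_val_child hγ hx
  rcases val_total hr (γ ++ [c]) (γ ++ [c']) with h | h
  · exact hmax hc' h hx'
  · exact h hx'

/-- The absence of a non-improving infinite ascending sequence of deviations. -/
def NoAscent (own : Set (List C)) (v : (ℕ → C) → O) (r : O → O → Prop) : Prop :=
  ∀ (pc : ℕ → ℕ → C) (p : ℕ → C) (φ : ℕ → ℕ), StrictMono φ → (∀ n, pre p (φ n) ∈ own) →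
    (∀ n, pre (pc n) (φ n) = pre p (φ n)) → (∀ n, pc n (φ n) ≠ p (φ n)) →
    (∀ n, r (v (pc n)) (v (pc (n + 1)))) → ∀ n, r (v (pc n)) (v p)

lemma NoAscent.false_of_step (hr : SWO r) (hA : NoAscent own v r) {p : ℕ → C} {E : Set O}
    (hp : v p ∈ E) (hstep : ∀ n x, x ∈ E → ¬ r x (v p) → ∃ q m, n ≤ m ∧ pre p m ∈ own ∧
      pre q m = pre p m ∧ q m ≠ p m ∧ r x (v q) ∧ v q ∈ E) : False := by
  have hstep' : ∀ z : {z : (ℕ → C) × ℕ // v z.1 ∈ E ∧ ¬ r (v z.1) (v p)},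
      ∃ z' : {z : (ℕ → C) × ℕ // v z.1 ∈ E ∧ ¬ r (v z.1) (v p)},
        z.1.2 < z'.1.2 ∧ pre p z'.1.2 ∈ own ∧ pre z'.1.1 z'.1.2 = pre p z'.1.2 ∧
        z'.1.1 z'.1.2 ≠ p z'.1.2 ∧ r (v z.1.1) (v z'.1.1) := by
    rintro ⟨⟨q, m⟩, h1, h2⟩
    obtain ⟨q', m', h3, h4, h5, h6, h7, h8⟩ := hstep (m + 1) (v q) h1 h2
    exact ⟨⟨(q', m'), h8, fun h => h2 (hr.2.1 _ _ _ h7 h)⟩, h3, h4, h5, h6, h7⟩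
  choose f hf using hstep'
  let z₀ : {z : (ℕ → C) × ℕ // v z.1 ∈ E ∧ ¬ r (v z.1) (v p)} := ⟨(p, 0), hp, hr.1 _⟩
  have hit (n : ℕ) : f^[n + 1] z₀ = f (f^[n] z₀) := Function.iterate_succ_apply' f n z₀
  have h0 := hA (fun n => (f^[n + 1] z₀).1.1) p (fun n => (f^[n + 1] z₀).1.2)
    (strictMono_nat_of_lt_succ fun n => by rw [hit (n + 1)]; exact (hf _).1)
    (fun n => by rw [hit n]; exact (hf _).2.1)
    (fun n => by simp only [hit n]; exact (hf _).2.2.1)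
    (fun n => by simp only [hit n]; exact (hf _).2.2.2.1)
    (fun n => by rw [hit (n + 1)]; exact (hf _).2.2.2.2) 0
  exact (f z₀).2.2 h0

variable [TopologicalSpace C] [DiscreteTopology C]

lemma force_not_of_notMem_val (hT : IsTree T) (hr : SWO r)
    (hB : ∀ I, Terminal r I → @MeasurableSet _ (borel (ℕ → C)) (v ⁻¹' I)) {γ : List C}
    (hγ : γ ∈ T) {x : O} (hx : x ∉ Val T own v r γ) : Force T ownᶜ γ {p | ¬ r x (v p)} := by
  refine (force_or_force own hT hγ (hB {o | r x o} fun o ho o' h => ?_)).resolve_left hx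
  by_contra h'
  exact hr.2.2 x o' o h' h ho

lemma force_notMem_val (hT : IsTree T) (hfin : ∀ t ∈ T, {c | t ++ [c] ∈ T}.Finite)
    (hr : SWO r) (hB : ∀ I, Terminal r I → @MeasurableSet _ (borel (ℕ → C)) (v ⁻¹' I))
    (hA : NoAscent own v r) {γ : List C} (hγ : γ ∈ T) :
    Force T own γ {p | v p ∉ Val T own v r γ} := by
  classical
  refine (force_or_force own hT hγ (hB {o | o ∉ Val T own v r γ} fun o ho o' h h' =>
    ho (val_lower hr h' h))).resolve_right ?_
  rintro ⟨τ, hτ, hf⟩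
  have hgood : ∀ t, ∃ c, (t ∈ T → t ++ [c] ∈ T) ∧ (t ∉ own → c = τ t) ∧
      (t ∈ T → t ∈ own → Val T own v r t ⊆ Val T own v r (t ++ [c])) := by
    intro t
    by_cases ht : t ∈ T ∧ t ∈ own
    · obtain ⟨c, h1, h2⟩ := exists_val_subset_child (own := own) (v := v) hT hr ht.1 (hfin t ht.1)
      exact ⟨c, fun _ => h1, fun h => absurd ht.2 h, fun _ _ => h2⟩
    · exact ⟨τ t, hτ t, fun _ => rfl, fun h h' => absurd ⟨h, h'⟩ ht⟩
  choose g hg using hgood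
  have hgs : IsStrat T g := fun t => (hg t).1
  set p := play g γ with hp
  have hpT := play_mem hT hgs hγ
  have hpγ := pre_play_length g γ
  rw [← hp] at hpT hpγ
  have hpτ : ∀ n, γ.length ≤ n → pre p n ∈ ownᶜ → p n = τ (pre p n) := fun n hn ho => by
    rw [hp, play_of_le g γ hn, ← hp, (hg _).2.1 ho]
  have hD : ∀ n, γ.length ≤ n → Val T own v r γ ⊆ Val T own v r (pre p n) := by
    intro n hn
    induction n, hn using Nat.le_induction with
    | base => rw [hpγ]
    | succ n hn ih =>
      refine ih.trans ?_
      rw [pre_succ]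
      by_cases ho : pre p n ∈ own
      · rw [hp, play_of_le g γ hn, ← hp]
        exact (hg _).2.2 (hpT n) ho
      · exact val_subset_child ho
  refine hA.false_of_step hr (E := Val T own v r γ) (not_not.1 (hf p hpT hpγ hpτ)) ?_
  intro n x hx hxp
  set N := max n γ.length with hN
  obtain ⟨s, hs, h⟩ := hD N (le_max_right _ _) hx
  obtain ⟨q, hq1, hq2, hq3⟩ := exists_play_of_both own hT hs hτ (hpT N)
  rw [length_pre] at hq2
  simp only [length_pre] at hq3 h
  have hxq : r x (v q) := h q hq1 hq2 fun k hk => (hq3 k hk).1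
  have hqγ : pre q γ.length = γ := by
    rw [← take_pre q (le_max_right n γ.length), ← hN, hq2, take_pre p (le_max_right _ _), hpγ]
  have hqτ : ∀ k, γ.length ≤ k → pre q k ∈ ownᶜ → q k = τ (pre q k) := by
    intro k hk ho
    rcases le_or_gt N k with hNk | hNk
    · exact (hq3 k hNk).2 ho
    · have h1 : pre q k = pre p k := by
        rw [← take_pre q hNk.le, hq2, take_pre p hNk.le]
      rw [h1] at ho ⊢
      rw [← hpτ k hk ho]
      exact pre_eq_iff.1 hq2 k hNk
  have hvq : v q ∈ Val T own v r γ := not_not.1 (hf q hq1 hqγ hqτ)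
  obtain ⟨m, hm, hm'⟩ := exists_first_ne (p := p) (q := q) (by
    rintro rfl
    exact hxp hxq)
  have hNm : N ≤ m := by
    by_contra h'
    exact hm' (pre_eq_iff.1 hq2 m (not_le.1 h'))
  refine ⟨q, m, (le_max_left _ _).trans hNm, ?_, hm, hm', hxq, hvq⟩
  by_contra ho
  have hγm := (le_max_right n γ.length).trans hNm
  refine hm' ?_
  rw [hqτ m hγm (by rwa [hm]), hm, hpτ m hγm ho]

lemma notMem_val_of_increasing (hT : IsTree T) (hr : SWO r)
    (hB : ∀ I, Terminal r I → @MeasurableSet _ (borel (ℕ → C)) (v ⁻¹' I))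
    (hA : NoAscent own v r) {p : ℕ → C} (hpT : ∀ n, pre p n ∈ T)
    (hmono : ∀ m n, m ≤ n → Val T own v r (pre p m) ⊆ Val T own v r (pre p n))
    (hinc : ∀ n, ∃ m, ¬ Val T own v r (pre p m) ⊆ Val T own v r (pre p n)) (n : ℕ) :
    v p ∉ Val T own v r (pre p n) := by
  classical
  intro hp
  refine hA.false_of_step hr (E := ⋃ n, Val T own v r (pre p n)) (Set.mem_iUnion.2 ⟨n, hp⟩) ?_
  clear hp n
  intro n x hx hxp
  obtain ⟨k, hk⟩ := Set.mem_iUnion.1 hx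
  set N := max n k with hN
  obtain ⟨s, hs, h⟩ := hmono k N (le_max_right _ _) hk
  simp only [length_pre] at h
  have hex : ∃ m, N ≤ m ∧ pre p m ∈ own ∧ p m ≠ s (pre p m) := by
    by_contra! h'
    exact hxp (h p hpT rfl h')
  have hmin := fun i => Nat.find_min hex (m := i)
  obtain ⟨h1, h2, h3⟩ := Nat.find_spec hex
  set m := Nat.find hex
  obtain ⟨M, hM⟩ := hinc m
  obtain ⟨z, hz, hz'⟩ := Set.not_subset.1 hM
  have hc : pre p m ++ [s (pre p m)] ∈ T := hs _ (hpT m)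
  obtain ⟨τ, hτ, hf⟩ := force_not_of_notMem_val hT hr hB hc
    fun h' => hz' (val_child_subset h2 hc h')
  obtain ⟨q, hq1, hq2, hq3⟩ := exists_play_of_both own hT hs hτ hc
  have hzq : ¬ r z (v q) := hf q hq1 hq2 fun k hk => (hq3 k hk).2
  obtain ⟨hq4, hq5⟩ := of_pre_concat hq2
  simp only [List.length_append, List.length_singleton, length_pre] at hq3 hq4 hq5
  have hxq : r x (v q) := by
    refine h q hq1 ?_ fun i hi ho => ?_
    · rw [← take_pre q h1, hq4, take_pre p h1]
    · rcases lt_trichotomy i m with him | rfl | him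
      · have hpre : pre q i = pre p i := by rw [← take_pre q him.le, hq4, take_pre p him.le]
        rw [hpre] at ho ⊢
        have := hmin i him
        push Not at this
        rw [← this hi ho]
        exact pre_eq_iff.1 hq4 i him
      · rw [hq5, hq4]
      · exact (hq3 i him).1 ho
  refine ⟨q, m, (le_max_left _ _).trans h1, h2, hq4, by rw [hq5]; exact h3.symm, hxq, ?_⟩
  exact Set.mem_iUnion.2 ⟨M, val_lower hr hz hzq⟩

end Value

end SeqGame

namespace SeqGame

variable {A : Type*} {C : Type u} {O : Type*}

section Optimal

variable [TopologicalSpace C] [DiscreteTopology C]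

lemma exists_optimal_play {T : Set (List C)} (hT : IsTree T)
    (hfin : ∀ t ∈ T, {c | t ++ [c] ∈ T}.Finite) (d : List C → A) (v : (ℕ → C) → O)
    (prec : A → O → O → Prop) (hr : ∀ a, SWO (prec a))
    (hB : ∀ a I, Terminal (prec a) I → @MeasurableSet _ (borel (ℕ → C)) (v ⁻¹' I))
    (hA : ∀ a, NoAscent {t | d t = a} v (prec a)) :
    ∃ p : ℕ → C, (∀ n, pre p n ∈ T) ∧
      ∀ a n, v p ∉ Val T {t | d t = a} v (prec a) (pre p n) := by
  classical
  let D : A → List C → Set O := fun a => Val T {t | d t = a} v (prec a)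
  have hopt : ∀ a γ, ∃ s, IsStrat T s ∧ (γ ∈ T → ∀ p, (∀ n, pre p n ∈ T) →
      pre p γ.length = γ → (∀ n, γ.length ≤ n → d (pre p n) = a → p n = s (pre p n)) →
      v p ∉ D a γ) := by
    intro a γ
    by_cases hγ : γ ∈ T
    · obtain ⟨s, hs, h⟩ := force_notMem_val hT hfin (hr a) (hB a) (hA a) hγ
      exact ⟨s, hs, fun _ => h⟩
    · obtain ⟨s, hs, -⟩ := force_notMem_val hT hfin (hr a) (hB a) (hA a) hT.nil
      exact ⟨s, hs, fun h => absurd h hγ⟩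
  choose s hs hopt using hopt
  let idx : A → List C → ℕ := fun a h => sInf {n | D a (h.take n) = D a h}
  let σ : List C → C := fun h => s (d h) (h.take (idx (d h) h)) h
  have hσ : IsStrat T σ := fun t ht => hs _ _ t ht
  set p := play σ [] with hp
  have hpT := play_mem hT hσ hT.nil
  rw [← hp] at hpT
  have hpσ : ∀ n, p n = σ (pre p n) := fun n => play_of_le σ [] (Nat.zero_le n)
  have hidx : ∀ a N, ∃ n ≤ N, D a (pre p n) = D a (pre p N) ∧ ∀ i, n ≤ i →
      D a (pre p i) = D a (pre p N) → d (pre p i) = a → p i = s a (pre p n) (pre p i) := by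
    intro a N
    have hex : ∃ n, D a (pre p n) = D a (pre p N) := ⟨N, rfl⟩
    refine ⟨Nat.find hex, Nat.find_min' hex rfl, Nat.find_spec hex, fun i hi h hd => ?_⟩
    have : idx a (pre p i) = Nat.find hex := by
      refine le_antisymm (Nat.sInf_le ?_) ?_
      · change D a ((pre p i).take _) = D a (pre p i)
        rw [take_pre p hi, h, Nat.find_spec hex]
      · by_contra! hlt
        have hmem : idx a (pre p i) ∈ {n | D a ((pre p i).take n) = D a (pre p i)} :=
          Nat.sInf_mem ⟨i, by change D a ((pre p i).take _) = _; rw [take_pre p le_rfl]⟩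
        change D a ((pre p i).take _) = D a (pre p i) at hmem
        rw [take_pre p (hlt.le.trans hi), h] at hmem
        exact Nat.find_min hex hlt hmem
    rw [hpσ i]
    simp only [σ]
    rw [hd, this, take_pre p hi]
  have hmono : ∀ a m n, m ≤ n → D a (pre p m) ⊆ D a (pre p n) := by
    intro a
    suffices h : ∀ N m n, m ≤ n → n ≤ N → D a (pre p m) ⊆ D a (pre p n) from
      fun m n hmn => h n m n hmn le_rfl
    intro N
    induction N with
    | zero =>
      intro m n hmn hn
      rw [show m = n by omega]
    | succ N ih =>
      suffices h : D a (pre p N) ⊆ D a (pre p (N + 1)) by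
        intro m n hmn hn
        rcases hn.eq_or_lt with rfl | hn
        · rcases hmn.eq_or_lt with rfl | hmn
          · exact subset_rfl
          · exact (ih m N (by omega) le_rfl).trans h
        · exact ih m n hmn (by omega)
      by_cases ho : d (pre p N) = a
      · intro x hx
        by_contra hx'
        obtain ⟨τ, hτ, hf⟩ := force_not_of_notMem_val hT (hr a) (hB a) (hpT (N + 1)) hx'
        obtain ⟨k, hkN, hk, hks⟩ := hidx a N
        obtain ⟨q, hq1, hq2, hq3⟩ := exists_play_of_both {t | d t = a} hT
          (hs a (pre p k)) hτ (hpT (N + 1))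
        have hxq : ¬ prec a x (v q) := hf q hq1 hq2 fun i hi => (hq3 i hi).2
        simp only [length_pre] at hq2 hq3
        refine hopt a (pre p k) (hpT k) q hq1 ?_ (fun i hi hd => ?_)
          (hk ▸ val_lower (hr a) hx hxq)
        · rw [length_pre, ← take_pre q (hkN.trans N.le_succ), hq2,
            take_pre p (hkN.trans N.le_succ)]
        · rw [length_pre] at hi
          rcases le_or_gt (N + 1) i with hNi | hNi
          · exact (hq3 i hNi).1 hd
          · have hpre : pre q i = pre p i := by
              rw [← take_pre q hNi.le, hq2, take_pre p hNi.le]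
            rw [hpre] at hd ⊢
            have hiN : i ≤ N := Nat.le_of_lt_succ hNi
            rw [← hks i hi ((ih i N hiN le_rfl).antisymm (hk ▸ ih k i hi hiN)) hd]
            exact pre_eq_iff.1 hq2 i hNi
      · rw [pre_succ]
        exact val_subset_child ho
  refine ⟨p, hpT, fun a n hn => ?_⟩
  by_cases hinc : ∀ n, ∃ m, ¬ D a (pre p m) ⊆ D a (pre p n)
  · exact notMem_val_of_increasing hT (hr a) (hB a) (hA a) hpT (hmono a) hinc n hn
  · push Not at hinc
    obtain ⟨N, hN⟩ := hinc
    obtain ⟨k, hkN, hk, hks⟩ := hidx a N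
    refine hopt a (pre p k) (hpT k) p hpT (by rw [length_pre]) (fun i hi hd => ?_) ?_
    · rw [length_pre] at hi
      exact hks i hi ((hN i).antisymm (hk ▸ hmono a k i hi)) hd
    · rw [hk]
      exact hN n hn

lemma exists_nash {T : Set (List C)} (hT : IsTree T)
    (hfin : ∀ t ∈ T, {c | t ++ [c] ∈ T}.Finite) (d : List C → A) (v : (ℕ → C) → O)
    (prec : A → O → O → Prop) (hr : ∀ a, SWO (prec a))
    (hB : ∀ a I, Terminal (prec a) I → @MeasurableSet _ (borel (ℕ → C)) (v ⁻¹' I))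
    (hA : ∀ a, NoAscent {t | d t = a} v (prec a)) :
    ∃ σ : List C → C, IsStrat T σ ∧ ∀ (a : A) (σ' : List C → C), IsStrat T σ' →
      (∀ t ∈ T, d t ≠ a → σ' t = σ t) → ¬ prec a (v (play σ [])) (v (play σ' [])) := by
  classical
  obtain ⟨p, hpT, hp⟩ := exists_optimal_play hT hfin d v prec hr hB hA
  have hpun : ∀ a γ, ∃ s, IsStrat T s ∧ (γ ∈ T → v p ∉ Val T {t | d t = a} v (prec a) γ →
      ∀ q, (∀ n, pre q n ∈ T) → pre q γ.length = γ →
      (∀ n, γ.length ≤ n → d (pre q n) ≠ a → q n = s (pre q n)) → ¬ prec a (v p) (v q)) := by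
    intro a γ
    by_cases hγ : γ ∈ T ∧ v p ∉ Val T {t | d t = a} v (prec a) γ
    · obtain ⟨s, hs, h⟩ := force_not_of_notMem_val hT (hr a) (hB a) hγ.1 hγ.2
      exact ⟨s, hs, fun _ _ => h⟩
    · choose s hs using hT.child
      refine ⟨fun t => if h : t ∈ T then s t h else p 0, fun t ht => ?_,
        fun h h' => absurd ⟨h, h'⟩ hγ⟩
      simp only [dif_pos ht]
      exact hs t ht
  choose τ hτ hpun using hpun
  let exit : List C → ℕ := fun h => sInf {k | h.take k ≠ pre p k}
  let σ : List C → C := fun h => if h = pre p h.length then p h.length else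
    τ (d (pre p (exit h - 1))) (h.take (exit h)) h
  have hσp : ∀ n, σ (pre p n) = p n := fun n => by
    simp only [σ, length_pre, if_true]
  have hσ : IsStrat T σ := fun t ht => by
    by_cases h : t = pre p t.length
    · rw [h, hσp, ← pre_succ]
      exact hpT _
    · simp only [σ, if_neg h]
      exact hτ _ _ t ht
  have hplay : play σ [] = p := by
    funext n
    induction n using Nat.strong_induction_on with
    | _ n ih => rw [play_of_le σ [] (Nat.zero_le n), pre_eq_iff.2 ih, hσp]
  refine ⟨σ, hσ, fun a σ' hσ' hdev hlt => ?_⟩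
  rw [hplay] at hlt
  set q := play σ' [] with hq
  have hqT := play_mem hT hσ' hT.nil
  rw [← hq] at hqT
  have hqσ : ∀ n, q n = σ' (pre q n) := fun n => play_of_le σ' [] (Nat.zero_le n)
  obtain ⟨m, hm, hm'⟩ := exists_first_ne (p := p) (q := q) fun h => (hr a).1 _ (h ▸ hlt)
  have ho : d (pre p m) = a := by
    by_contra ho
    refine hm' ?_
    rw [hqσ, hm, hdev _ (hpT m) ho, hσp]
  have hne : pre q (m + 1) ≠ pre p (m + 1) := fun h => hm' (pre_eq_iff.1 h m (Nat.lt_succ_self m))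
  have hexit : ∀ n, m + 1 ≤ n → exit (pre q n) = m + 1 := by
    intro n hn
    refine le_antisymm (Nat.sInf_le ?_) (le_csInf ⟨m + 1, ?_⟩ fun k hk => ?_)
    · change (pre q n).take (m + 1) ≠ pre p (m + 1)
      rwa [take_pre q hn]
    · change (pre q n).take (m + 1) ≠ pre p (m + 1)
      rwa [take_pre q hn]
    · by_contra! hlt
      have hkm : k ≤ m := Nat.le_of_lt_succ hlt
      refine hk ?_
      rw [take_pre q (by omega), ← take_pre q hkm, hm, take_pre p hkm]
  refine hpun a (pre q (m + 1)) (hqT _) (fun h => hp a m ?_) q hqT (by rw [length_pre])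
    (fun n hn hd => ?_) hlt
  · rw [pre_succ, hm] at h
    exact val_child_subset ho (by rw [← hm, ← pre_succ]; exact hqT _) h
  · rw [length_pre] at hn
    rw [hqσ n, hdev _ (hqT n) hd]
    have : pre q n ≠ pre p (pre q n).length := by
      rw [length_pre]
      intro h
      refine hne ?_
      rw [← take_pre q hn, h, take_pre p hn]
    simp only [σ, if_neg this, hexit n hn, Nat.add_sub_cancel, ho, take_pre q hn]

end Optimal

/-- The tree of the prefixes of a play and of plays deviating from it at increasing positions. -/
def combTree (p : ℕ → C) (pc : ℕ → ℕ → C) : Set (List C) :=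
  {t | ∃ n, t = pre p n ∨ ∃ i, t = pre (pc i) n}

lemma pre_eq_of_le {p q : ℕ → C} {m n : ℕ} (h : pre p n = pre q n) (hmn : m ≤ n) :
    pre p m = pre q m := by
  rw [← take_pre p hmn, h, take_pre q hmn]

section Comb

variable {p : ℕ → C} {pc : ℕ → ℕ → C} {φ : ℕ → ℕ}

lemma child_of_mem_combTree (hag : ∀ n, pre (pc n) (φ n) = pre p (φ n)) {t : List C} {c : C} (hc : t ++ [c] ∈ combTree p pc) :
    (t = pre p t.length ∧ (c = p t.length ∨ ∃ i, φ i = t.length ∧ c = pc i t.length)) ∨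
      ∃ i, φ i < t.length ∧ t = pre (pc i) t.length ∧ c = pc i t.length := by
  obtain ⟨n, h⟩ := hc
  have key : ∀ q : ℕ → C, t ++ [c] = pre q n → t = pre q t.length ∧ c = q t.length := by
    intro q hq
    have hn := congrArg List.length hq
    rw [length_pre, List.length_append, List.length_singleton] at hn
    subst hn
    rw [pre_succ] at hq
    have := List.append_inj hq (length_pre _ _).symm
    exact ⟨this.1, by simpa using this.2⟩
  rcases h with h | ⟨i, h⟩
  · exact Or.inl ⟨(key p h).1, Or.inl (key p h).2⟩
  · obtain ⟨h1, h2⟩ := key _ h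
    rcases lt_trichotomy (φ i) t.length with h3 | h3 | h3
    · exact Or.inr ⟨i, h3, h1, h2⟩
    · refine Or.inl ⟨h1.trans (pre_eq_of_le (hag i) h3.ge), Or.inr ⟨i, h3, h2⟩⟩
    · refine Or.inl ⟨h1.trans (pre_eq_of_le (hag i) h3.le), Or.inl ?_⟩
      rw [h2]
      exact pre_eq_iff.1 (hag i) _ h3

lemma pc_unique (hφ : StrictMono φ) (hag : ∀ n, pre (pc n) (φ n) = pre p (φ n))
    (hne : ∀ n, pc n (φ n) ≠ p (φ n)) {i j n : ℕ} (hi : φ i < n) (hj : φ j < n)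
    (h : pre (pc i) n = pre (pc j) n) : i = j := by
  by_contra hij
  wlog hlt : i < j generalizing i j
  · exact this hj hi h.symm (Ne.symm hij) (by omega)
  have h1 := hφ hlt
  exact hne i ((pre_eq_iff.1 h _ hi).trans (pre_eq_iff.1 (hag j) _ h1))

lemma pre_pc_ne (hne : ∀ n, pc n (φ n) ≠ p (φ n)) {i n : ℕ} (hi : φ i < n) :
    pre (pc i) n ≠ pre p n := fun h => hne i (pre_eq_iff.1 h _ hi)

end Comb

end SeqGame

namespace SeqGame

variable {A : Type*} {C : Type u} {O : Type*}

section CombNash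

variable {p : ℕ → C} {pc : ℕ → ℕ → C} {φ : ℕ → ℕ}

lemma finite_children_combTree (hφ : StrictMono φ)
    (hag : ∀ n, pre (pc n) (φ n) = pre p (φ n)) (hne : ∀ n, pc n (φ n) ≠ p (φ n))
    (t : List C) : {c | t ++ [c] ∈ combTree p pc}.Finite := by
  have h1 : {c | ∃ i, φ i = t.length ∧ c = pc i t.length}.Subsingleton := by
    rintro c ⟨i, hi, rfl⟩ c' ⟨j, hj, rfl⟩
    rw [hφ.injective (hi.trans hj.symm)]
  have h2 : {c | ∃ i, φ i < t.length ∧ t = pre (pc i) t.length ∧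
      c = pc i t.length}.Subsingleton := by
    rintro c ⟨i, hi, hi', rfl⟩ c' ⟨j, hj, hj', rfl⟩
    rw [pc_unique hφ hag hne hi hj (hi'.symm.trans hj')]
  refine (((Set.finite_singleton (p t.length)).union h1.finite).union h2.finite).subset ?_
  intro c hc
  rcases child_of_mem_combTree hag hc with ⟨-, h | h⟩ | h
  exacts [Or.inl (Or.inl h), Or.inl (Or.inr h), Or.inr h]

lemma combTree_child_unique (hφ : StrictMono φ)
    (hag : ∀ n, pre (pc n) (φ n) = pre p (φ n)) (hne : ∀ n, pc n (φ n) ≠ p (φ n))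
    {t : List C} (ht : ∀ n, t ≠ pre p (φ n)) {c c' : C} (hc : t ++ [c] ∈ combTree p pc)
    (hc' : t ++ [c'] ∈ combTree p pc) : c = c' := by
  rcases child_of_mem_combTree hag hc with ⟨h, h1⟩ | ⟨i, hi, hi', rfl⟩ <;>
  rcases child_of_mem_combTree hag hc' with ⟨h', h1'⟩ | ⟨j, hj, hj', rfl⟩
  · rcases h1 with rfl | ⟨i, hi, -⟩
    · rcases h1' with rfl | ⟨i, hi, -⟩
      · rfl
      · exact absurd (hi ▸ h) (ht i)
    · exact absurd (hi ▸ h) (ht i)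
  · exact absurd (hj'.symm.trans h) (pre_pc_ne hne hj)
  · exact absurd (hi'.symm.trans h') (pre_pc_ne hne hi)
  · rw [pc_unique hφ hag hne hi hj (hi'.symm.trans hj')]

lemma eq_of_play_combTree (hφ : StrictMono φ)
    (hag : ∀ n, pre (pc n) (φ n) = pre p (φ n)) (hne : ∀ n, pc n (φ n) ≠ p (φ n))
    {q : ℕ → C} (hq : ∀ n, pre q n ∈ combTree p pc) : q = p ∨ ∃ i, q = pc i := by
  by_cases h : p = q
  · exact Or.inl h.symm
  obtain ⟨m, hm, hm'⟩ := exists_first_ne h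
  right
  have h1 := hq (m + 1)
  rw [pre_succ] at h1
  rcases child_of_mem_combTree hag h1 with ⟨-, h2 | ⟨i, hi, h2⟩⟩ | ⟨i, hi, h2, -⟩
  · rw [length_pre] at h2
    exact absurd h2 hm'
  · rw [length_pre] at hi h2
    have key : ∀ n, m + 1 ≤ n → pre q n = pre (pc i) n := by
      intro n hn
      induction n, hn using Nat.le_induction with
      | base => rw [pre_succ, pre_succ, hm, h2, ← hi, hag]
      | succ n hn ih =>
        have h3 := hq (n + 1)
        rw [pre_succ] at h3
        rw [pre_succ, pre_succ, ih]
        rcases child_of_mem_combTree hag h3 with ⟨h4, -⟩ | ⟨j, hj, h4, h5⟩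
        · rw [length_pre, ih] at h4
          exact absurd h4 (pre_pc_ne hne (by omega))
        · rw [length_pre] at hj h4 h5
          rw [h5, pc_unique hφ hag hne hj (show φ i < n by omega) (h4.symm.trans ih)]
    refine ⟨i, funext fun n => ?_⟩
    exact pre_eq_iff.1 (key (m + 1 + n) (by omega)) n (by omega)
  · rw [length_pre] at hi h2
    exact absurd (h2.symm.trans hm) (pre_pc_ne hne hi)

lemma noAscent_of_exists_nash {a : A} {d : List C → A} {v : (ℕ → C) → O}
    {r : O → O → Prop} (hr : SWO r)
    (hN : ∀ T : Set (List C), [] ∈ T → (∀ l l' : List C, l' ∈ T → l <+: l' → l ∈ T) →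
      (∀ t ∈ T, {c : C | t ++ [c] ∈ T}.Nonempty ∧ {c : C | t ++ [c] ∈ T}.Finite) →
      ∃ σ : List C → C, (∀ t ∈ T, t ++ [σ t] ∈ T) ∧
        ∀ σ' : List C → C, (∀ t ∈ T, t ++ [σ' t] ∈ T) → (∀ t ∈ T, d t ≠ a → σ' t = σ t) →
          ¬ r (v (play σ [])) (v (play σ' []))) :
    NoAscent {t | d t = a} v r := by
  classical
  intro pc p φ hφ hown hag hne hasc n
  have hnil : [] ∈ combTree p pc := ⟨0, Or.inl (pre_zero p).symm⟩
  have hpre : ∀ l l' : List C, l' ∈ combTree p pc → l <+: l' → l ∈ combTree p pc := by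
    rintro l l' ⟨n, h⟩ hl
    have hlen := hl.length_le
    rw [List.prefix_iff_eq_take] at hl
    refine ⟨l.length, ?_⟩
    rcases h with rfl | ⟨i, rfl⟩ <;> rw [length_pre] at hlen <;> rw [take_pre _ hlen] at hl
    exacts [Or.inl hl, Or.inr ⟨i, hl⟩]
  have hp : ∀ n, pre p n ∈ combTree p pc := fun n => ⟨n, Or.inl rfl⟩
  have hpc : ∀ i n, pre (pc i) n ∈ combTree p pc := fun i n => ⟨n, Or.inr ⟨i, rfl⟩⟩
  have hchild : ∀ t ∈ combTree p pc, {c : C | t ++ [c] ∈ combTree p pc}.Nonempty := by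
    rintro t ⟨n, rfl | ⟨i, rfl⟩⟩
    · exact ⟨p n, by rw [Set.mem_ofPred_eq, ← pre_succ]; exact hp _⟩
    · exact ⟨pc i n, by rw [Set.mem_ofPred_eq, ← pre_succ]; exact hpc _ _⟩
  obtain ⟨σ, hσ, hnash⟩ := hN (combTree p pc) hnil hpre fun t ht =>
    ⟨hchild t ht, finite_children_combTree hφ hag hne t⟩
  have hT : IsTree (combTree p pc) := ⟨hnil, hpre, hchild⟩
  have hdev : ∀ q : ℕ → C, (∀ n, pre q n ∈ combTree p pc) → ¬ r (v (play σ [])) (v q) := by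
    intro q hq
    let σ' : List C → C := fun t => if d t = a ∧ t = pre q t.length then q t.length else σ t
    have hplay : play σ' [] = q := by
      funext n
      induction n using Nat.strong_induction_on with
      | _ n ih =>
        rw [play_of_le σ' [] (Nat.zero_le n), pre_eq_iff.2 ih]
        by_cases h : d (pre q n) = a
        · simp only [σ', length_pre, and_true, if_pos h]
        · simp only [σ', length_pre, and_true, if_neg h]
          refine combTree_child_unique hφ hag hne (fun i h' => h ((congrArg d h').trans (hown i)))
            (hσ _ (hq n)) ?_
          rw [← pre_succ]
          exact hq _
    rw [← hplay]
    refine hnash σ' (fun t ht => ?_) fun t _ h => if_neg fun h' => h h'.1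
    by_cases h : d t = a ∧ t = pre q t.length
    · simp only [σ', if_pos h]
      have := hq (t.length + 1)
      rwa [pre_succ, ← h.2] at this
    · simp only [σ', if_neg h]
      exact hσ t ht
  by_contra hn
  rcases eq_of_play_combTree hφ hag hne (fun n => play_mem hT hσ hnil n) with h | ⟨i, h⟩
  · rw [h] at hdev
    exact hr.2.2 _ _ _ hn (hdev _ (hpc (n + 1))) (hasc n)
  · rw [h] at hdev
    exact hdev _ (hpc (i + 1)) (hasc i)

lemma tendsto_of_pre_eq [TopologicalSpace C] (hφ : StrictMono φ)
    (hag : ∀ n, pre (pc n) (φ n) = pre p (φ n)) :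
    Filter.Tendsto pc Filter.atTop (nhds p) := by
  refine tendsto_pi_nhds.2 fun i => tendsto_const_nhds.congr' ?_
  filter_upwards [Filter.eventually_gt_atTop i] with n hn
  exact (pre_eq_iff.1 (hag n) i (hn.trans_le (hφ.id_le n))).symm

end CombNash

end SeqGame

open SeqGame in
/-- for an infinite sequential game with strict weak order preferences and
Borel measurable preimages of terminal intervals, the "no infinitely ascending deviation
sequence" condition is equivalent to every finite-branching pruning having a Nash
equilibrium. -/
theorem stmt13 {A C O : Type*} [Nonempty A] [Nonempty C] [Nonempty O]
    [TopologicalSpace C] [DiscreteTopology C]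
    (d : List C → A) (v : (ℕ → C) → O) (prec : A → O → O → Prop)
    (hswo : ∀ a : A, SWO (prec a))
    (hborel : ∀ (a : A) (I : Set O), Terminal (prec a) I →
      @MeasurableSet (ℕ → C) (borel (ℕ → C)) (v ⁻¹' I)) :
    ((∀ (a : A) (pc : ℕ → ℕ → C) (p : ℕ → C) (φ : ℕ → ℕ), StrictMono φ →
        Filter.Tendsto pc Filter.atTop (nhds p) →
        (∀ n, d (pre p (φ n)) = a) →
        (∀ n, pre (pc n) (φ n) = pre p (φ n)) →
        (∀ n, pc n (φ n) ≠ p (φ n)) →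
        (∀ n, prec a (v (pc n)) (v (pc (n + 1)))) →
        ∀ n, prec a (v (pc n)) (v p))
      ↔
      (∀ T : Set (List C), [] ∈ T →
        (∀ l l' : List C, l' ∈ T → l <+: l' → l ∈ T) →
        (∀ t ∈ T, {c : C | t ++ [c] ∈ T}.Nonempty ∧ {c : C | t ++ [c] ∈ T}.Finite) →
        ∃ σ : List C → C, (∀ t ∈ T, t ++ [σ t] ∈ T) ∧
          ∀ (a : A) (σ' : List C → C), (∀ t ∈ T, t ++ [σ' t] ∈ T) →
            (∀ t ∈ T, d t ≠ a → σ' t = σ t) →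
            ¬ prec a (v (play σ [])) (v (play σ' [])))) := by
  refine ⟨fun h T hnil hpre hT => ?_, fun h a pc p φ hφ _ => ?_⟩
  · exact exists_nash ⟨hnil, hpre, fun t ht => (hT t ht).1⟩ (fun t ht => (hT t ht).2) d v prec
      hswo hborel fun a pc p φ hφ h1 h2 => h a pc p φ hφ (tendsto_of_pre_eq hφ h2) h1 h2
  · refine noAscent_of_exists_nash (hswo a) (fun T hnil hpre hT => ?_) pc p φ hφ
    obtain ⟨σ, hσ, hn⟩ := h T hnil hpre hT
    exact ⟨σ, hσ, hn a⟩
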